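/- arXiv:2103.11609 — 4 statements merged into one kernel-verified Lean document; each statement's English description precedes it below -/
import Mathlib

section
/- Let U be a finite set and let μ, ν be probability distributions on subsets of U with supp(ν) ⊆ supp(μ). Let P_μ be an irreducible, aperiodic transition matrix on supp(μ) that is reversible with respect to μ, and let P_ν be any transition matrix on supp(ν) for which ν is stationary. Then for any coupling of two faithful copies of P_μ, the total difference of marginals satisfies ∑_{j∈U} |Pr_{S∼μ}[j∈S] − Pr_{S∼ν}[j∈S]| ≤ E_{S∼ν}[ ∑_{T≠S} |P_μ(S→T) − P_ν(S→T)| · ∑_{t=0}^∞ E[d_H(X_t,Y_t) | X_0=S, Y_0=T] ]. -/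
open Finset

attribute [local instance] Classical.propDecidable

/-- `μ` is a probability distribution on the finite type `Ω`. -/
def IsProbDist {Ω : Type*} [Fintype Ω] (μ : Ω → ℝ) : Prop :=
  (∀ x, 0 ≤ μ x) ∧ ∑ x, μ x = 1

/-- `P` is a row-stochastic transition matrix whose dynamics is supported on `Ω₀`
(transitions out of `Ω₀` are impossible, and off `Ω₀` the matrix is extended as the identity,
so that `P` together with its powers faithfully represents a Markov chain on state space `Ω₀`). -/
def IsTransOn {Ω : Type*} [Fintype Ω] [DecidableEq Ω] (P : Matrix Ω Ω ℝ) (Ω₀ : Set Ω) : Prop :=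
  (∀ x y, 0 ≤ P x y) ∧ (∀ x, ∑ y, P x y = 1) ∧
    (∀ x ∈ Ω₀, ∀ y, P x y ≠ 0 → y ∈ Ω₀) ∧
    (∀ x, x ∉ Ω₀ → ∀ y, P x y = if x = y then 1 else 0)

/-- `P` is reversible with respect to `π`. -/
def ReversibleWrt {Ω : Type*} (P : Matrix Ω Ω ℝ) (π : Ω → ℝ) : Prop :=
  ∀ x y, π x * P x y = π y * P y x

/-- `π` is stationary for `P`. -/
def StationaryWrt {Ω : Type*} [Fintype Ω] (P : Matrix Ω Ω ℝ) (π : Ω → ℝ) : Prop :=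
  ∀ y, ∑ x, π x * P x y = π y

/-- `P` is irreducible on the state space `Ω₀`. -/
def IrreducibleOn {Ω : Type*} [Fintype Ω] [DecidableEq Ω] (P : Matrix Ω Ω ℝ) (Ω₀ : Set Ω) : Prop :=
  ∀ x ∈ Ω₀, ∀ y ∈ Ω₀, ∃ t : ℕ, 0 < (P ^ t) x y

/-- `P` is aperiodic on the state space `Ω₀`: for every state, the gcd of the return
times is `1` (every common divisor of the return times equals `1`). -/
def AperiodicOn {Ω : Type*} [Fintype Ω] [DecidableEq Ω] (P : Matrix Ω Ω ℝ) (Ω₀ : Set Ω) : Prop :=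
  ∀ x ∈ Ω₀, ∀ d : ℕ, 0 < d → (∀ t : ℕ, 0 < t → 0 < (P ^ t) x x → d ∣ t) → d = 1

/-- A coupling of two faithful copies of the chain `P`, recorded through its time-`t` joint
distributions: `coup x y t a b` is the probability that `(X t, Y t) = (a, b)` given the starting
states `X 0 = x` and `Y 0 = y`; marginally each copy evolves according to `P`. -/
def IsCoupling {Ω : Type*} [Fintype Ω] [DecidableEq Ω] (P : Matrix Ω Ω ℝ)
    (coup : Ω → Ω → ℕ → Ω → Ω → ℝ) : Prop :=
  (∀ x y t a b, 0 ≤ coup x y t a b) ∧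
    (∀ x y t a, ∑ b, coup x y t a b = (P ^ t) x a) ∧
    (∀ x y t b, ∑ a, coup x y t a b = (P ^ t) y b)

/-- Hamming distance between two finite sets: the size of their symmetric difference. -/
def hamm {U : Type*} [DecidableEq U] (S T : Finset U) : ℕ := ((S \ T) ∪ (T \ S)).card

/-- `margOf μ j = Pr_{S ∼ μ}[j ∈ S]`. -/
def margOf {U : Type*} [Fintype U] [DecidableEq U] (μ : Finset U → ℝ) (j : U) : ℝ :=
  ∑ S : Finset U, if j ∈ S then μ S else 0

/-- `μ` conditioned on the event `{S : A ⊆ S}`. -/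
noncomputable def condOn {U : Type*} [Fintype U] [DecidableEq U] (μ : Finset U → ℝ)
    (A : Finset U) : Finset U → ℝ := fun S =>
  if A ⊆ S then μ S / ∑ T : Finset U, (if A ⊆ T then μ T else 0) else 0

theorem Matrix.pow_mulVec_of_fixed {Ω : Type*} [Fintype Ω] [DecidableEq Ω] {P : Matrix Ω Ω ℝ}
    {h : Ω → ℝ} (hh : P.mulVec h = h) (t : ℕ) : (P ^ t).mulVec h = h := by
  induction t with
  | zero => simp
  | succ t ih => rw [pow_succ, ← Matrix.mulVec_mulVec, hh, ih]

theorem Matrix.pow_row_sum {Ω : Type*} [Fintype Ω] [DecidableEq Ω] {P : Matrix Ω Ω ℝ}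
    (hP : ∀ x, ∑ y, P x y = 1) (t : ℕ) (x : Ω) : ∑ y, (P ^ t) x y = 1 := by
  have h1 : P.mulVec (fun _ => 1) = fun _ => 1 := by
    funext x
    simp [Matrix.mulVec, dotProduct, hP]
  simpa [Matrix.mulVec, dotProduct] using congrFun (Matrix.pow_mulVec_of_fixed h1 t) x

/-- A reversible irreducible chain has only one stationary distribution: the density of a
stationary distribution with respect to the reversing one is harmonic, hence constant. -/
theorem eq_of_stationaryWrt_of_reversibleWrt {Ω : Type*} [Fintype Ω] [DecidableEq Ω]
    {P : Matrix Ω Ω ℝ} {μ ρ : Ω → ℝ} (hμ : IsProbDist μ) (hP : IsTransOn P {x | μ x ≠ 0})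
    (hirr : IrreducibleOn P {x | μ x ≠ 0}) (hrev : ReversibleWrt P μ) (hρ : IsProbDist ρ)
    (hac : ∀ x, μ x = 0 → ρ x = 0) (hst : StationaryWrt P ρ) : ρ = μ := by
  obtain ⟨hP0, hP1, -, hPout⟩ := hP
  set h : Ω → ℝ := fun x => ρ x / μ x with hh
  have hmul : ∀ x, ρ x = h x * μ x := fun x => by
    by_cases hx : μ x = 0
    · simp [hx, hac x hx]
    · simp [hh, hx]
  have hharm : P.mulVec h = h := by
    funext x
    simp only [Matrix.mulVec, dotProduct]
    by_cases hx : μ x = 0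
    · simp [hPout x (by simpa using hx)]
    · apply mul_left_cancel₀ hx
      rw [mul_comm (μ x) (h x), ← hmul, ← hst x, Finset.mul_sum]
      refine Finset.sum_congr rfl fun y _ => ?_
      rw [← mul_assoc, hrev x y, hmul y]
      ring
  have : Nonempty Ω := by
    by_contra hne
    rw [not_nonempty_iff] at hne
    simpa using hμ.2
  obtain ⟨x₀, hx₀⟩ := Finite.exists_max h
  have hx₀μ : μ x₀ ≠ 0 := by
    intro h0
    have hz : ∀ x, ρ x = 0 := fun x => by
      have h1 : h x ≤ 0 := by simpa [hh, h0] using hx₀ x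
      refine le_antisymm ?_ (hρ.1 x)
      rw [hmul x]
      exact mul_nonpos_of_nonpos_of_nonneg h1 (hμ.1 x)
    simpa [hz] using hρ.2
  have hconst : ∀ y, μ y ≠ 0 → h y = h x₀ := by
    intro y hy
    obtain ⟨t, ht⟩ := hirr x₀ hx₀μ y hy
    have hsum : ∑ z, (P ^ t) x₀ z * (h x₀ - h z) = 0 := by
      have h1 := congrFun (Matrix.pow_mulVec_of_fixed hharm t) x₀
      simp only [Matrix.mulVec, dotProduct] at h1
      simp only [mul_sub, Finset.sum_sub_distrib, h1, ← Finset.sum_mul, Matrix.pow_row_sum hP1]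
      ring
    have h2 := (Finset.sum_eq_zero_iff_of_nonneg fun z _ =>
      mul_nonneg (Matrix.pow_apply_nonneg hP0 t x₀ z) (sub_nonneg.2 (hx₀ z))).1 hsum y
      (Finset.mem_univ y)
    rcases mul_eq_zero.1 h2 with h3 | h3
    · exact absurd h3 ht.ne'
    · linarith
  have hprop : ∀ y, ρ y = h x₀ * μ y := fun y => by
    by_cases hy : μ y = 0
    · simp [hy, hac y hy]
    · rw [hmul y, hconst y hy]
  have hone : h x₀ = 1 := by
    have h1 := hρ.2
    simp_rw [hprop, ← Finset.mul_sum, hμ.2, mul_one] at h1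
    exact h1
  funext y
  rw [hprop, hone, one_mul]

/-- If the orbit of a vector under a matrix stays in a compact convex set, then that set contains
a fixed vector, namely a limit point of the Cesàro averages. -/
theorem exists_vecMul_fixed_of_orbit_mem {Ω : Type*} [Fintype Ω] [DecidableEq Ω]
    (P : Matrix Ω Ω ℝ) (ν : Ω → ℝ) {K : Set (Ω → ℝ)} (hK : IsCompact K) (hconv : Convex ℝ K)
    (horb : ∀ t : ℕ, Matrix.vecMul ν (P ^ t) ∈ K) : ∃ ρ ∈ K, Matrix.vecMul ρ P = ρ := by
  set p : ℕ → Ω → ℝ := fun t => Matrix.vecMul ν (P ^ t) with hp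
  have hps : ∀ t, Matrix.vecMul (p t) P = p (t + 1) := fun t => by
    simp [hp, pow_succ, Matrix.vecMul_vecMul]
  set A : ℕ → Ω → ℝ := fun N => ∑ t ∈ Finset.range (N + 1), ((N : ℝ) + 1)⁻¹ • p t with hA
  have hAK : ∀ N, A N ∈ K := fun N => by
    refine hconv.sum_mem (fun _ _ => by positivity) ?_ fun t _ => horb t
    simp only [Finset.sum_const, Finset.card_range, nsmul_eq_mul]
    push_cast
    exact mul_inv_cancel₀ (by positivity)
  obtain ⟨ρ, hρK, φ, hφ, hlim⟩ := hK.tendsto_subseq hAK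
  refine ⟨ρ, hρK, ?_⟩
  have hdiff : ∀ N, Matrix.vecMul (A N) P - A N = ((N : ℝ) + 1)⁻¹ • (p (N + 1) - p 0) := fun N => by
    simp only [hA, ← Finset.smul_sum, Matrix.smul_vecMul, Matrix.sum_vecMul, hps]
    rw [← smul_sub, ← Finset.sum_sub_distrib, Finset.sum_range_sub]
  have hzero : Filter.Tendsto (fun N : ℕ => ((N : ℝ) + 1)⁻¹ • (p (N + 1) - p 0)) Filter.atTop
      (nhds 0) := by
    obtain ⟨C, hC⟩ := hK.isBounded.exists_norm_le
    have hbdd : ∀ N, ‖p (N + 1) - p 0‖ ≤ C + C := fun N =>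
      (norm_sub_le _ _).trans (add_le_add (hC _ (horb _)) (hC _ (horb _)))
    refine squeeze_zero_norm (a := fun N : ℕ => ((N : ℝ) + 1)⁻¹ * (C + C)) (fun N => ?_) ?_
    · rw [norm_smul, Real.norm_of_nonneg (by positivity)]
      exact mul_le_mul_of_nonneg_left (hbdd N) (by positivity)
    · simpa [one_div] using tendsto_one_div_add_atTop_nhds_zero_nat (𝕜 := ℝ) |>.mul_const (C + C)
  have hcont : Continuous fun v : Ω → ℝ => Matrix.vecMul v P - v := by fun_prop
  have h1 := (hcont.tendsto ρ).comp hlim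
  have h2 := hzero.comp hφ.tendsto_atTop
  refine sub_eq_zero.1 (tendsto_nhds_unique h1 (h2.congr fun n => ?_))
  simp only [Function.comp_apply, hdiff]

/-- Telescoping comparison of the chain `P` started from a stationary distribution of `Q`. -/
theorem dotProduct_pow_mulVec_sub {Ω : Type*} [Fintype Ω] [DecidableEq Ω] {P Q : Matrix Ω Ω ℝ}
    {ν : Ω → ℝ} (hP : ∀ x, ∑ y, P x y = 1) (hQ : ∀ x, ∑ y, Q x y = 1) (hst : StationaryWrt Q ν)
    (f : Ω → ℝ) (N : ℕ) :
    ν ⬝ᵥ (P ^ N).mulVec f - ν ⬝ᵥ f = ∑ t ∈ Finset.range N, ∑ x, ν x *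
      ∑ y ∈ Finset.univ.erase x, (P x y - Q x y) *
        ((P ^ t).mulVec f y - (P ^ t).mulVec f x) := by
  have hQν : Matrix.vecMul ν Q = ν := funext hst
  have hstep : ∀ t : ℕ, ν ⬝ᵥ (P ^ (t + 1)).mulVec f - ν ⬝ᵥ (P ^ t).mulVec f = ∑ x, ν x *
      ∑ y ∈ Finset.univ.erase x, (P x y - Q x y) *
        ((P ^ t).mulVec f y - (P ^ t).mulVec f x) := fun t => by
    generalize hg : (P ^ t).mulVec f = g
    have h1 : ν ⬝ᵥ g = ν ⬝ᵥ Q.mulVec g := by rw [Matrix.dotProduct_mulVec ν Q g, hQν]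
    rw [pow_succ', ← Matrix.mulVec_mulVec, hg, h1, ← dotProduct_sub, ← Matrix.sub_mulVec]
    refine Finset.sum_congr rfl fun x _ => ?_
    rw [Finset.sum_erase _ (by simp)]
    simp only [mul_sub, Finset.sum_sub_distrib, ← Finset.sum_mul, hP, hQ]
    simp [Matrix.mulVec, dotProduct]
  rw [← Finset.sum_congr rfl fun t _ => hstep t,
    Finset.sum_range_sub fun t => ν ⬝ᵥ (P ^ t).mulVec f]
  simp

/-- The number of elements on which two sets differ, as a sum of differences of indicators. -/
theorem sum_abs_indicator_sub {U : Type*} [Fintype U] [DecidableEq U] (a b : Finset U) :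
    ∑ j : U, |(if j ∈ a then (1 : ℝ) else 0) - (if j ∈ b then 1 else 0)| = hamm a b := by
  have h : ∀ j : U, |(if j ∈ a then (1 : ℝ) else 0) - (if j ∈ b then 1 else 0)| =
      if j ∈ (a \ b) ∪ (b \ a) then 1 else 0 := fun j => by
    by_cases ha : j ∈ a <;> by_cases hb : j ∈ b <;> simp [ha, hb]
  simp only [h, hamm, Finset.sum_ite_mem, Finset.univ_inter, Finset.sum_const, nsmul_eq_mul,
    mul_one]

/-- The expectations of the two copies of a coupled chain differ by at most the expected
difference. -/
theorem IsCoupling.abs_mulVec_sub_le {Ω : Type*} [Fintype Ω] [DecidableEq Ω] {P : Matrix Ω Ω ℝ}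
    {coup : Ω → Ω → ℕ → Ω → Ω → ℝ} (hc : IsCoupling P coup) (f : Ω → ℝ) (t : ℕ) (x y : Ω) :
    |(P ^ t).mulVec f y - (P ^ t).mulVec f x| ≤ ∑ a, ∑ b, coup x y t a b * |f a - f b| := by
  obtain ⟨h0, hl, hr⟩ := hc
  have hx : (P ^ t).mulVec f x = ∑ a, ∑ b, coup x y t a b * f a := by
    simp only [Matrix.mulVec, dotProduct, ← hl x y, Finset.sum_mul]
  have hy : (P ^ t).mulVec f y = ∑ a, ∑ b, coup x y t a b * f b := by
    rw [Finset.sum_comm]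
    simp only [Matrix.mulVec, dotProduct, ← hr x y, Finset.sum_mul]
  rw [abs_sub_comm, hx, hy]
  simp only [← Finset.sum_sub_distrib, ← mul_sub]
  refine (Finset.abs_sum_le_sum_abs _ _).trans (Finset.sum_le_sum fun a _ => ?_)
  refine (Finset.abs_sum_le_sum_abs _ _).trans (Finset.sum_le_sum fun b _ => ?_)
  rw [abs_mul, abs_of_nonneg (h0 x y t a b)]

theorem margOf_eq_dotProduct {U : Type*} [Fintype U] [DecidableEq U] (μ : Finset U → ℝ) (j : U) :
    margOf μ j = μ ⬝ᵥ fun S => if j ∈ S then (1 : ℝ) else 0 := by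
  simp [margOf, dotProduct]

/-- Finite-time version of the marginal bound. -/
theorem sum_abs_margOf_vecMul_pow_sub_le {U : Type*} [Fintype U] [DecidableEq U]
    {ν : Finset U → ℝ} (hν : ∀ S, 0 ≤ ν S) {P Q : Matrix (Finset U) (Finset U) ℝ}
    (hP : ∀ S, ∑ T, P S T = 1) (hQ : ∀ S, ∑ T, Q S T = 1) (hst : StationaryWrt Q ν)
    {coup : Finset U → Finset U → ℕ → Finset U → Finset U → ℝ} (hc : IsCoupling P coup) (N : ℕ) :
    ∑ j : U, |margOf (Matrix.vecMul ν (P ^ N)) j - margOf ν j| ≤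
      ∑ S, ν S * ∑ T ∈ Finset.univ.erase S, |P S T - Q S T| *
        ∑ t ∈ Finset.range N, ∑ a, ∑ b, coup S T t a b * (hamm a b : ℝ) := by
  set f : U → Finset U → ℝ := fun j S => if j ∈ S then 1 else 0 with hf
  have hj : ∀ j, |margOf (Matrix.vecMul ν (P ^ N)) j - margOf ν j| ≤
      ∑ S, ν S * ∑ T ∈ Finset.univ.erase S, |P S T - Q S T| *
        ∑ t ∈ Finset.range N, ∑ a, ∑ b, coup S T t a b * |f j a - f j b| := fun j => by
    rw [margOf_eq_dotProduct, margOf_eq_dotProduct, ← Matrix.dotProduct_mulVec,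
      dotProduct_pow_mulVec_sub hP hQ hst, Finset.sum_comm]
    simp only [← Finset.mul_sum]
    refine (Finset.abs_sum_le_sum_abs _ _).trans (Finset.sum_le_sum fun S _ => ?_)
    rw [abs_mul, abs_of_nonneg (hν S), Finset.sum_comm]
    refine mul_le_mul_of_nonneg_left ?_ (hν S)
    simp only [← Finset.mul_sum]
    refine (Finset.abs_sum_le_sum_abs _ _).trans (Finset.sum_le_sum fun T _ => ?_)
    rw [abs_mul]
    refine mul_le_mul_of_nonneg_left ?_ (abs_nonneg _)
    exact (Finset.abs_sum_le_sum_abs _ _).trans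
      (Finset.sum_le_sum fun t _ => hc.abs_mulVec_sub_le (f j) t S T)
  refine (Finset.sum_le_sum fun j _ => hj j).trans (le_of_eq ?_)
  rw [Finset.sum_comm]
  refine Finset.sum_congr rfl fun S _ => ?_
  rw [← Finset.mul_sum, Finset.sum_comm]
  congr 1
  refine Finset.sum_congr rfl fun T _ => ?_
  rw [← Finset.mul_sum, Finset.sum_comm]
  congr 1
  refine Finset.sum_congr rfl fun t _ => ?_
  rw [Finset.sum_comm]
  refine Finset.sum_congr rfl fun a _ => ?_
  rw [Finset.sum_comm]
  refine Finset.sum_congr rfl fun b _ => ?_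
  rw [← Finset.mul_sum, sum_abs_indicator_sub]

theorem convex_setOf_sum_abs_margOf_sub_le {U : Type*} [Fintype U] [DecidableEq U]
    (ν : Finset U → ℝ) (C : ℝ) :
    Convex ℝ {ρ : Finset U → ℝ | ∑ j : U, |margOf ρ j - margOf ν j| ≤ C} := by
  intro ρ hρ σ hσ a b ha hb hab
  simp only [Set.mem_ofPred_eq] at hρ hσ ⊢
  calc ∑ j : U, |margOf (a • ρ + b • σ) j - margOf ν j|
      ≤ ∑ j : U, (a * |margOf ρ j - margOf ν j| + b * |margOf σ j - margOf ν j|) := by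
        refine Finset.sum_le_sum fun j _ => ?_
        have h1 : margOf (a • ρ + b • σ) j - margOf ν j =
            a * (margOf ρ j - margOf ν j) + b * (margOf σ j - margOf ν j) := by
          rw [margOf_eq_dotProduct, add_dotProduct, smul_dotProduct, smul_dotProduct,
            ← margOf_eq_dotProduct, ← margOf_eq_dotProduct, smul_eq_mul, smul_eq_mul]
          linear_combination margOf ν j * hab
        rw [h1]
        refine (abs_add_le _ _).trans (le_of_eq ?_)
        rw [abs_mul, abs_mul, abs_of_nonneg ha, abs_of_nonneg hb]
    _ = a * ∑ j : U, |margOf ρ j - margOf ν j| + b * ∑ j : U, |margOf σ j - margOf ν j| := by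
        rw [Finset.sum_add_distrib, Finset.mul_sum, Finset.mul_sum]
    _ ≤ a * C + b * C := by gcongr
    _ = C := by rw [← add_mul, hab, one_mul]

theorem isClosed_setOf_sum_abs_margOf_sub_le {U : Type*} [Fintype U] [DecidableEq U]
    (ν : Finset U → ℝ) (C : ℝ) :
    IsClosed {ρ : Finset U → ℝ | ∑ j : U, |margOf ρ j - margOf ν j| ≤ C} := by
  refine isClosed_le ?_ continuous_const
  simp only [margOf_eq_dotProduct, dotProduct]
  fun_prop

/-- A chain never leaves the state space it is supported on. -/
theorem IsTransOn.vecMul_pow_apply_eq_zero {Ω : Type*} [Fintype Ω] [DecidableEq Ω]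
    {P : Matrix Ω Ω ℝ} {Ω₀ : Set Ω} (hP : IsTransOn P Ω₀) {ν : Ω → ℝ}
    (hν : ∀ x, x ∉ Ω₀ → ν x = 0) (t : ℕ) {x : Ω} (hx : x ∉ Ω₀) :
    Matrix.vecMul ν (P ^ t) x = 0 := by
  induction t generalizing x with
  | zero => simpa using hν x hx
  | succ t ih =>
    rw [pow_succ, ← Matrix.vecMul_vecMul]
    simp only [Matrix.vecMul, dotProduct]
    refine Finset.sum_eq_zero fun y _ => ?_
    by_cases hy : y ∈ Ω₀
    · rw [by_contra fun h => hx (hP.2.2.1 y hy x h), mul_zero]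
    · rw [show ∑ z, ν z * (P ^ t) z y = 0 from ih hy, zero_mul]

theorem IsProbDist.vecMul_pow {Ω : Type*} [Fintype Ω] [DecidableEq Ω] {P : Matrix Ω Ω ℝ}
    {Ω₀ : Set Ω} (hP : IsTransOn P Ω₀) {ν : Ω → ℝ} (hν : IsProbDist ν) (t : ℕ) :
    IsProbDist (Matrix.vecMul ν (P ^ t)) := by
  refine ⟨fun y => Finset.sum_nonneg fun x _ =>
    mul_nonneg (hν.1 x) (Matrix.pow_apply_nonneg hP.1 t x y), ?_⟩
  simp only [Matrix.vecMul, dotProduct]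
  rw [Finset.sum_comm]
  simp only [← Finset.mul_sum, Matrix.pow_row_sum hP.2.1, mul_one, hν.2]

/-- main technical bound on the total difference of marginals.
Let `μ, ν` be probability distributions on subsets of a finite set `U` with
`supp ν ⊆ supp μ`, let `Pμ` be an irreducible aperiodic transition matrix on `supp μ`
reversible w.r.t. `μ`, and let `Pν` be any transition matrix on `supp ν` for which `ν` is
stationary.  Then for any coupling of two faithful copies of `Pμ`,
`∑_j |Pr_{S∼μ}[j∈S] − Pr_{S∼ν}[j∈S]|` is at most
`E_{S∼ν}[ ∑_{T≠S} |Pμ(S→T) − Pν(S→T)| · ∑_{t=0}^∞ E[d_H(X_t,Y_t) ∣ X_0=S, Y_0=T] ]`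
(the inner infinite sum of expected Hamming distances is taken in `ℝ≥0∞`). -/
theorem marginal_difference_le_stein_bound
    {U : Type*} [Fintype U] [DecidableEq U]
    (μ ν : Finset U → ℝ) (hμ : IsProbDist μ) (hν : IsProbDist ν)
    (hsupp : ∀ S, ν S ≠ 0 → μ S ≠ 0)
    (Pμ Pν : Matrix (Finset U) (Finset U) ℝ)
    (hPμ : IsTransOn Pμ {S | μ S ≠ 0})
    (hirr : IrreducibleOn Pμ {S | μ S ≠ 0})
    (haper : AperiodicOn Pμ {S | μ S ≠ 0})
    (hrev : ReversibleWrt Pμ μ)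
    (hPν : IsTransOn Pν {S | ν S ≠ 0})
    (hstat : StationaryWrt Pν ν)
    (coup : Finset U → Finset U → ℕ → Finset U → Finset U → ℝ)
    (hcoup : IsCoupling Pμ coup) :
    ENNReal.ofReal (∑ j : U, |margOf μ j - margOf ν j|) ≤
      ∑ S : Finset U, ENNReal.ofReal (ν S) *
        ∑ T ∈ Finset.univ.erase S, ENNReal.ofReal |Pμ S T - Pν S T| *
          ∑' t : ℕ, ENNReal.ofReal (∑ a : Finset U, ∑ b : Finset U,
            coup S T t a b * (hamm a b : ℝ)) := by
  set R : ENNReal := ∑ S : Finset U, ENNReal.ofReal (ν S) *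
    ∑ T ∈ Finset.univ.erase S, ENNReal.ofReal |Pμ S T - Pν S T| *
      ∑' t : ℕ, ENNReal.ofReal (∑ a : Finset U, ∑ b : Finset U,
        coup S T t a b * (hamm a b : ℝ))
  by_cases htop : R = ⊤
  · rw [htop]
    exact le_top
  rw [ENNReal.ofReal_le_iff_le_toReal htop]
  have hfin : ∀ N : ℕ,
      ∑ j : U, |margOf (Matrix.vecMul ν (Pμ ^ N)) j - margOf ν j| ≤ R.toReal := fun N => by
    refine (sum_abs_margOf_vecMul_pow_sub_le hν.1 hPμ.2.1 hPν.2.1 hstat hcoup N).trans ?_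
    rw [← ENNReal.ofReal_le_iff_le_toReal htop]
    have hD : ∀ S T t, 0 ≤ ∑ a : Finset U, ∑ b : Finset U, coup S T t a b * (hamm a b : ℝ) :=
      fun S T t => Finset.sum_nonneg fun a _ => Finset.sum_nonneg fun b _ =>
        mul_nonneg (hcoup.1 S T t a b) (Nat.cast_nonneg _)
    have hDN : ∀ S T, 0 ≤ |Pμ S T - Pν S T| * ∑ t ∈ Finset.range N,
        ∑ a : Finset U, ∑ b : Finset U, coup S T t a b * (hamm a b : ℝ) := fun S T =>
      mul_nonneg (abs_nonneg _) (Finset.sum_nonneg fun t _ => hD S T t)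
    rw [ENNReal.ofReal_sum_of_nonneg fun S _ =>
      mul_nonneg (hν.1 S) (Finset.sum_nonneg fun T _ => hDN S T)]
    refine Finset.sum_le_sum fun S _ => ?_
    rw [ENNReal.ofReal_mul (hν.1 S), ENNReal.ofReal_sum_of_nonneg fun T _ => hDN S T]
    refine mul_le_mul_right (Finset.sum_le_sum fun T _ => ?_) _
    rw [ENNReal.ofReal_mul (abs_nonneg _), ENNReal.ofReal_sum_of_nonneg fun t _ => hD S T t]
    exact mul_le_mul_right (ENNReal.sum_le_tsum _) _
  have hν0 : ∀ S, S ∉ {S | μ S ≠ 0} → ν S = 0 := fun S hS =>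
    by_contra fun h => hS (hsupp S h)
  set Z : Set (Finset U → ℝ) := {ρ | ∀ S, μ S = 0 → ρ S = 0} with hZ
  have hZclosed : IsClosed Z := by
    simp only [hZ, Set.ofPred_forall]
    exact isClosed_iInter fun S => isClosed_iInter fun _ =>
      isClosed_eq (continuous_apply S) continuous_const
  have hZconv : Convex ℝ Z := fun ρ hρ σ hσ a b _ _ _ S hS => by
    simp [hρ S hS, hσ S hS]
  obtain ⟨ρ, ⟨⟨hρ, hρZ⟩, hρR⟩, hfix⟩ := exists_vecMul_fixed_of_orbit_mem Pμ ν
    (((isCompact_stdSimplex ℝ (Finset U)).inter_right hZclosed).inter_right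
      (isClosed_setOf_sum_abs_margOf_sub_le ν R.toReal))
    (((convex_stdSimplex ℝ (Finset U)).inter hZconv).inter
      (convex_setOf_sum_abs_margOf_sub_le ν R.toReal))
    (fun t => ⟨⟨hν.vecMul_pow hPμ t, fun S hS =>
      hPμ.vecMul_pow_apply_eq_zero hν0 t (by simpa using hS)⟩, hfin t⟩)
  rwa [← eq_of_stationaryWrt_of_reversibleWrt hμ hPμ hirr hrev hρ hρZ fun S => congrFun hfix S]
end

section
/- Let U be a finite set and let μ, ν be probability distributions on subsets of U with supp(ν) ⊆ supp(μ). Let P_μ be an irreducible, aperiodic transition matrix on supp(μ) that is reversible with respect to μ, and let P_ν be any transition matrix on supp(ν) for which ν is stationary. Then for any coupling of two faithful copies of P_μ, the 1-Wasserstein distance with respect to Hamming distance satisfies W_1(μ,ν) ≤ E_{S∼ν}[ ∑_{T≠S} |P_μ(S→T) − P_ν(S→T)| · ∑_{t=0}^∞ E[d_H(X_t,Y_t) | X_0=S, Y_0=T] ]. -/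
open Finset

attribute [local instance] Classical.propDecidable

open Matrix in
/-- Fredholm alternative for symmetric real matrices: a vector orthogonal to the kernel
lies in the range. -/
theorem Matrix.IsSymm.exists_mulVec_eq {Ω : Type*} [Fintype Ω] [DecidableEq Ω]
    {A : Matrix Ω Ω ℝ} (hA : A.IsSymm) {b : Ω → ℝ}
    (hb : ∀ v, A *ᵥ v = 0 → b ⬝ᵥ v = 0) : ∃ h, A *ᵥ h = b := by
  have hsymm : (Matrix.toEuclideanLin A).IsSymmetric := by
    rw [Matrix.isSymmetric_toEuclideanLin_iff]
    rw [Matrix.IsHermitian, Matrix.conjTranspose_eq_transpose_of_trivial, hA.eq]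
  have hmem : WithLp.toLp 2 b ∈ LinearMap.range (Matrix.toEuclideanLin A) := by
    rw [← Submodule.orthogonal_orthogonal (LinearMap.range (Matrix.toEuclideanLin A)),
      hsymm.orthogonal_range, Submodule.mem_orthogonal]
    intro u hu
    have hu' : A *ᵥ u.ofLp = 0 := by
      simpa [Matrix.toLpLin_apply] using hu
    simpa [EuclideanSpace.inner_eq_star_dotProduct] using hb _ hu'
  obtain ⟨h, hh⟩ := hmem
  exact ⟨h.ofLp, by simpa [Matrix.toLpLin_apply] using congrArg WithLp.ofLp hh⟩

section Chain

open Matrix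

variable {Ω : Type*} [Fintype Ω] [DecidableEq Ω] {P : Matrix Ω Ω ℝ} {Ω₀ : Set Ω}

theorem IsTransOn.pow_nonneg (hP : IsTransOn P Ω₀) (t : ℕ) (x y : Ω) : 0 ≤ (P ^ t) x y := by
  induction t generalizing y with
  | zero => rw [pow_zero, Matrix.one_apply]; split_ifs <;> norm_num
  | succ t ih =>
    rw [pow_succ, Matrix.mul_apply]
    exact Finset.sum_nonneg fun z _ => mul_nonneg (ih z) (hP.1 z y)

theorem IsTransOn.sum_pow (hP : IsTransOn P Ω₀) (t : ℕ) (x : Ω) : ∑ y, (P ^ t) x y = 1 := by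
  induction t with
  | zero => simp [Matrix.one_apply]
  | succ t ih =>
    simp only [pow_succ, Matrix.mul_apply]
    rw [Finset.sum_comm]
    simp only [← Finset.mul_sum, hP.2.1, mul_one, ih]

theorem IsTransOn.mem_of_pow_ne_zero (hP : IsTransOn P Ω₀) {t : ℕ} {x y : Ω} (hx : x ∈ Ω₀)
    (hxy : (P ^ t) x y ≠ 0) : y ∈ Ω₀ := by
  induction t generalizing y with
  | zero =>
    rw [pow_zero, Matrix.one_apply] at hxy
    have : x = y := by by_contra hne; simp [hne] at hxy
    exact this ▸ hx
  | succ t ih =>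
    rw [pow_succ, Matrix.mul_apply] at hxy
    obtain ⟨z, -, hz⟩ := Finset.exists_ne_zero_of_sum_ne_zero hxy
    exact hP.2.2.1 z (ih (left_ne_zero_of_mul hz)) y (right_ne_zero_of_mul hz)

/-- A power of the chain, started in the state space, only sees values on the state space. -/
theorem IsTransOn.pow_mulVec_congr (hP : IsTransOn P Ω₀) {g h : Ω → ℝ}
    (hgh : ∀ x ∈ Ω₀, g x = h x) (t : ℕ) {x : Ω} (hx : x ∈ Ω₀) :
    (P ^ t *ᵥ g) x = (P ^ t *ᵥ h) x := by
  simp only [Matrix.mulVec, dotProduct]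
  refine Finset.sum_congr rfl fun y _ => ?_
  by_cases hy : (P ^ t) x y = 0
  · simp [hy]
  · rw [hgh y (hP.mem_of_pow_ne_zero hx hy)]

/-- Harmonic functions of an irreducible finite chain are constant. -/
theorem IsTransOn.eq_of_harmonic (hP : IsTransOn P Ω₀) (hirr : IrreducibleOn P Ω₀) {h : Ω → ℝ}
    (hh : ∀ x ∈ Ω₀, (P *ᵥ h) x = h x) {x y : Ω} (hx : x ∈ Ω₀) (hy : y ∈ Ω₀) : h x = h y := by
  have hpow : ∀ t : ℕ, ∀ x ∈ Ω₀, (P ^ t *ᵥ h) x = h x := by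
    intro t
    induction t with
    | zero => simp
    | succ t ih =>
      intro x hx
      rw [pow_succ, ← Matrix.mulVec_mulVec, hP.pow_mulVec_congr hh t hx, ih x hx]
  obtain ⟨m, hm, hmax⟩ := Set.exists_max_image Ω₀ h (Set.toFinite _) ⟨x, hx⟩
  have key : ∀ y ∈ Ω₀, h y = h m := by
    intro y hy
    obtain ⟨t, ht⟩ := hirr m hm y hy
    have hsum : ∑ z, (P ^ t) m z * (h m - h z) = 0 := by
      have := hpow t m hm
      simp only [Matrix.mulVec, dotProduct] at this
      simp only [mul_sub, Finset.sum_sub_distrib, ← Finset.sum_mul, hP.sum_pow, this]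
      ring
    rw [Finset.sum_eq_zero_iff_of_nonneg] at hsum
    · have := (mul_eq_zero.mp (hsum y (Finset.mem_univ y))).resolve_left ht.ne'
      linarith
    · intro z _
      by_cases hz : (P ^ t) m z = 0
      · simp [hz]
      · exact mul_nonneg (hP.pow_nonneg t m z)
          (sub_nonneg.mpr (hmax z (hP.mem_of_pow_ne_zero hm hz)))
  rw [key x hx, key y hy]

/-- Solvability of the Poisson equation for an irreducible reversible finite chain. -/
theorem exists_poisson {μ : Ω → ℝ} (hμ : IsProbDist μ) (hP : IsTransOn P {x | μ x ≠ 0})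
    (hirr : IrreducibleOn P {x | μ x ≠ 0}) (hrev : ReversibleWrt P μ) (f : Ω → ℝ) :
    ∃ h : Ω → ℝ, ∀ x, μ x ≠ 0 → h x - (P *ᵥ h) x = f x - ∑ y, μ y * f y := by
  set c := ∑ y, μ y * f y with hc
  have hmul : ∀ v x, ((Matrix.diagonal μ * (1 - P)) *ᵥ v) x = μ x * (v x - (P *ᵥ v) x) := by
    intro v x
    rw [← Matrix.mulVec_mulVec, Matrix.mulVec_diagonal, Matrix.sub_mulVec, Matrix.one_mulVec,
      Pi.sub_apply]
  have hsymm : (Matrix.diagonal μ * (1 - P)).IsSymm := by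
    ext x y
    simp only [Matrix.transpose_apply, Matrix.diagonal_mul, Matrix.sub_apply, mul_sub, hrev y x]
    rcases eq_or_ne x y with rfl | hxy
    · rfl
    · simp [hxy, hxy.symm]
  obtain ⟨h, hh⟩ := hsymm.exists_mulVec_eq (b := fun x => μ x * (f x - c)) <| by
    intro v hv
    have hharm : ∀ x ∈ {x | μ x ≠ 0}, (P *ᵥ v) x = v x := by
      intro x hx
      have := congrFun hv x
      rw [hmul, Pi.zero_apply] at this
      have := (mul_eq_zero.mp this).resolve_left hx
      linarith
    obtain ⟨m, -, hm⟩ : ∃ m ∈ Finset.univ, μ m ≠ 0 :=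
      Finset.exists_ne_zero_of_sum_ne_zero (by rw [hμ.2]; exact one_ne_zero)
    have hterm : ∀ x, μ x * (f x - c) * v x = (μ x * f x - μ x * c) * v m := by
      intro x
      by_cases hx : μ x = 0
      · simp [hx]
      · rw [hP.eq_of_harmonic hirr hharm (x := x) (y := m) hx hm]
        ring
    simp only [dotProduct, hterm]
    rw [← Finset.sum_mul, Finset.sum_sub_distrib, ← Finset.sum_mul, hμ.2, ← hc]
    ring
  refine ⟨h, fun x hx => ?_⟩
  have := congrFun hh x
  rw [hmul] at this
  exact mul_left_cancel₀ hx this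

/-- Iterating the Poisson equation. -/
theorem IsTransOn.eq_sum_add_of_poisson (hP : IsTransOn P Ω₀) {f h : Ω → ℝ} {c : ℝ}
    (hh : ∀ x ∈ Ω₀, h x - (P *ᵥ h) x = f x - c) {x : Ω} (hx : x ∈ Ω₀) (n : ℕ) :
    h x = ∑ t ∈ Finset.range n, ((P ^ t *ᵥ f) x - c) + (P ^ n *ᵥ h) x := by
  induction n with
  | zero => simp
  | succ n ih =>
    have hstep : (P ^ n *ᵥ h) x = (P ^ n *ᵥ (P *ᵥ h + f - fun _ => c)) x :=
      hP.pow_mulVec_congr (fun y hy => by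
        have := hh y hy
        simp only [Pi.add_apply, Pi.sub_apply]
        linarith) n hx
    have hconst : (P ^ n *ᵥ fun _ => c) x = c := by
      simp only [Matrix.mulVec, dotProduct, ← Finset.sum_mul, hP.sum_pow, one_mul]
    rw [Matrix.mulVec_sub, Matrix.mulVec_add, Matrix.mulVec_mulVec, ← pow_succ, Pi.sub_apply,
      Pi.add_apply, hconst] at hstep
    rw [Finset.sum_range_succ]
    linarith

/-- A coupling controls differences of expectations of functions that are Lipschitz with respect
to a cost `d`. -/
theorem IsCoupling.abs_sub_le {coup : Ω → Ω → ℕ → Ω → Ω → ℝ} (hcoup : IsCoupling P coup)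
    {g : Ω → ℝ} {K : ℝ} {d : Ω → Ω → ℝ} (hg : ∀ a b, |g a - g b| ≤ K * d a b)
    (x y : Ω) (t : ℕ) :
    |(P ^ t *ᵥ g) x - (P ^ t *ᵥ g) y| ≤ K * ∑ a, ∑ b, coup x y t a b * d a b := by
  have hx : (P ^ t *ᵥ g) x = ∑ a, ∑ b, coup x y t a b * g a := by
    simp only [Matrix.mulVec, dotProduct, ← Finset.sum_mul, hcoup.2.1]
  have hy : (P ^ t *ᵥ g) y = ∑ a, ∑ b, coup x y t a b * g b := by
    rw [Finset.sum_comm]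
    simp only [Matrix.mulVec, dotProduct, ← Finset.sum_mul, hcoup.2.2]
  rw [hx, hy, ← Finset.sum_sub_distrib, Finset.mul_sum]
  refine (Finset.abs_sum_le_sum_abs _ _).trans (Finset.sum_le_sum fun a _ => ?_)
  rw [← Finset.sum_sub_distrib, Finset.mul_sum]
  refine (Finset.abs_sum_le_sum_abs _ _).trans (Finset.sum_le_sum fun b _ => ?_)
  rw [← mul_sub, abs_mul, abs_of_nonneg (hcoup.1 x y t a b)]
  calc coup x y t a b * |g a - g b| ≤ coup x y t a b * (K * d a b) :=
        mul_le_mul_of_nonneg_left (hg a b) (hcoup.1 x y t a b)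
    _ = K * (coup x y t a b * d a b) := by ring

/-- Lipschitz bound for a solution of the Poisson equation in terms of a coupling. -/
theorem IsCoupling.poisson_le_tsum (hP : IsTransOn P Ω₀) {coup : Ω → Ω → ℕ → Ω → Ω → ℝ}
    (hcoup : IsCoupling P coup) {d : Ω → Ω → ℝ} {f h : Ω → ℝ} {c K : ℝ}
    (hf : ∀ a b, |f a - f b| ≤ d a b) (hK : 0 ≤ K) (hhd : ∀ a b, |h a - h b| ≤ K * d a b)
    (hh : ∀ x ∈ Ω₀, h x - (P *ᵥ h) x = f x - c) {x y : Ω} (hx : x ∈ Ω₀) (hy : y ∈ Ω₀) :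
    ENNReal.ofReal |h x - h y| ≤
      ∑' t : ℕ, ENNReal.ofReal (∑ a, ∑ b, coup x y t a b * d a b) := by
  set D : ℕ → ℝ := fun t => ∑ a, ∑ b, coup x y t a b * d a b with hD
  have hD0 : ∀ t, 0 ≤ D t := fun t => Finset.sum_nonneg fun a _ => Finset.sum_nonneg fun b _ =>
    mul_nonneg (hcoup.1 x y t a b) ((abs_nonneg _).trans (hf a b))
  have hbound : ∀ n, |h x - h y| ≤ ∑ t ∈ Finset.range n, D t + K * D n := by
    intro n
    rw [hP.eq_sum_add_of_poisson hh hx n, hP.eq_sum_add_of_poisson hh hy n, add_sub_add_comm,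
      ← Finset.sum_sub_distrib]
    refine (abs_add_le _ _).trans (add_le_add ?_ (hcoup.abs_sub_le hhd x y n))
    refine (Finset.abs_sum_le_sum_abs _ _).trans (Finset.sum_le_sum fun t _ => ?_)
    rw [sub_sub_sub_cancel_right]
    simpa using hcoup.abs_sub_le (K := 1) (by simpa using hf) x y t
  change _ ≤ ∑' t : ℕ, ENNReal.ofReal (D t)
  by_cases htop : ∑' t : ℕ, ENNReal.ofReal (D t) = ⊤
  · rw [htop]
    exact le_top
  have hlim := (ENNReal.Tendsto.const_mul (a := ENNReal.ofReal K)
    (ENNReal.tendsto_atTop_zero_of_tsum_ne_top htop) (Or.inr ENNReal.ofReal_ne_top)).const_add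
    (∑' t : ℕ, ENNReal.ofReal (D t))
  rw [mul_zero, add_zero] at hlim
  refine ge_of_tendsto' hlim fun n => ?_
  calc ENNReal.ofReal |h x - h y|
      ≤ ENNReal.ofReal (∑ t ∈ Finset.range n, D t + K * D n) :=
        ENNReal.ofReal_le_ofReal (hbound n)
    _ = ∑ t ∈ Finset.range n, ENNReal.ofReal (D t) +
          ENNReal.ofReal K * ENNReal.ofReal (D n) := by
        rw [ENNReal.ofReal_add (Finset.sum_nonneg fun t _ => hD0 t) (mul_nonneg hK (hD0 n)),
          ENNReal.ofReal_sum_of_nonneg fun t _ => hD0 t, ENNReal.ofReal_mul hK]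
    _ ≤ _ := by
        gcongr
        exact ENNReal.sum_le_tsum _

end Chain

open Matrix in
/-- Stein's identity: comparison of expectations through two transition matrices. -/
theorem sub_eq_sum_of_poisson {Ω : Type*} [Fintype Ω] {μ ν : Ω → ℝ} {P Q : Matrix Ω Ω ℝ}
    (hν : IsProbDist ν)
    (hsupp : ∀ x, ν x ≠ 0 → μ x ≠ 0) (hP : ∀ x, ∑ y, P x y = 1) (hQ : ∀ x, ∑ y, Q x y = 1)
    (hstat : StationaryWrt Q ν) {f h : Ω → ℝ} {c : ℝ}
    (hh : ∀ x, μ x ≠ 0 → h x - (P *ᵥ h) x = f x - c) :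
    c - ∑ x, ν x * f x = ∑ x, ν x * ∑ y, (P x y - Q x y) * (h y - h x) := by
  have hinner : ∀ x, ∑ y, (P x y - Q x y) * (h y - h x) = (P *ᵥ h) x - (Q *ᵥ h) x := by
    intro x
    simp only [mul_sub, sub_mul, Finset.sum_sub_distrib, ← Finset.sum_mul, hP, hQ,
      Matrix.mulVec, dotProduct]
    ring
  have hQh : ∑ x, ν x * (Q *ᵥ h) x = ∑ x, ν x * h x := by
    simp only [Matrix.mulVec, dotProduct, Finset.mul_sum]
    rw [Finset.sum_comm]
    refine Finset.sum_congr rfl fun y _ => ?_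
    rw [← hstat y, Finset.sum_mul]
    exact Finset.sum_congr rfl fun x _ => by ring
  have hPh : ∀ x, ν x * (P *ᵥ h) x = ν x * h x - ν x * f x + ν x * c := by
    intro x
    by_cases hx : ν x = 0
    · simp [hx]
    · rw [show (P *ᵥ h) x = h x - f x + c by linarith [hh x (hsupp x hx)]]
      ring
  simp only [hinner]
  simp only [mul_sub, Finset.sum_sub_distrib, hQh, hPh, Finset.sum_add_distrib,
    ← Finset.sum_mul, hν.2]
  ring

/-- Every function of finite sets is Lipschitz with respect to Hamming distance. -/
theorem exists_lipschitz_hamm {U : Type*} [Fintype U] [DecidableEq U] (h : Finset U → ℝ) :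
    ∃ K : ℝ, 0 ≤ K ∧ ∀ S T, |h S - h T| ≤ K * (hamm S T : ℝ) := by
  refine ⟨∑ S, ∑ T, |h S - h T|, by positivity, fun S T => ?_⟩
  rcases eq_or_ne S T with rfl | hne
  · simp [hamm]
  have hpos : (1 : ℝ) ≤ hamm S T := by
    rw [Nat.one_le_cast, Nat.one_le_iff_ne_zero]
    intro h0
    rw [hamm, Finset.card_eq_zero, Finset.union_eq_empty, Finset.sdiff_eq_empty_iff_subset,
      Finset.sdiff_eq_empty_iff_subset] at h0
    exact hne (h0.1.antisymm h0.2)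
  have hle : |h S - h T| ≤ ∑ S, ∑ T, |h S - h T| :=
    (Finset.single_le_sum (f := fun T => |h S - h T|) (fun _ _ => abs_nonneg _)
      (Finset.mem_univ T)).trans
    (Finset.single_le_sum (f := fun S => ∑ T, |h S - h T|)
      (fun _ _ => Finset.sum_nonneg fun _ _ => abs_nonneg _) (Finset.mem_univ S))
  exact hle.trans (le_mul_of_one_le_right ((abs_nonneg _).trans hle) hpos)

/-- main technical bound on the 1-Wasserstein distance w.r.t. Hamming
distance.  Under the same hypotheses as the bound on marginal differences, for any coupling
of two faithful copies of `Pμ`, the 1-Wasserstein distance `W₁(μ,ν)` w.r.t. Hamming distance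
(expressed through its defining property: `|E_μ f − E_ν f|` is bounded for every `f` that is
1-Lipschitz w.r.t. Hamming distance) is at most
`E_{S∼ν}[ ∑_{T≠S} |Pμ(S→T) − Pν(S→T)| · ∑_{t=0}^∞ E[d_H(X_t,Y_t) ∣ X_0=S, Y_0=T] ]`. -/
theorem wasserstein_le_stein_bound
    {U : Type*} [Fintype U] [DecidableEq U]
    (μ ν : Finset U → ℝ) (hμ : IsProbDist μ) (hν : IsProbDist ν)
    (hsupp : ∀ S, ν S ≠ 0 → μ S ≠ 0)
    (Pμ Pν : Matrix (Finset U) (Finset U) ℝ)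
    (hPμ : IsTransOn Pμ {S | μ S ≠ 0})
    (hirr : IrreducibleOn Pμ {S | μ S ≠ 0})
    (haper : AperiodicOn Pμ {S | μ S ≠ 0})
    (hrev : ReversibleWrt Pμ μ)
    (hPν : IsTransOn Pν {S | ν S ≠ 0})
    (hstat : StationaryWrt Pν ν)
    (coup : Finset U → Finset U → ℕ → Finset U → Finset U → ℝ)
    (hcoup : IsCoupling Pμ coup) :
    ∀ f : Finset U → ℝ, (∀ S T : Finset U, |f S - f T| ≤ (hamm S T : ℝ)) →
      ENNReal.ofReal |(∑ S : Finset U, μ S * f S) - ∑ S : Finset U, ν S * f S| ≤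
        ∑ S : Finset U, ENNReal.ofReal (ν S) *
          ∑ T ∈ Finset.univ.erase S, ENNReal.ofReal |Pμ S T - Pν S T| *
            ∑' t : ℕ, ENNReal.ofReal (∑ a : Finset U, ∑ b : Finset U,
              coup S T t a b * (hamm a b : ℝ)) := by
  intro f hf
  obtain ⟨h, hh⟩ := exists_poisson hμ hPμ hirr hrev f
  obtain ⟨K, hK, hhK⟩ := exists_lipschitz_hamm h
  rw [sub_eq_sum_of_poisson hν hsupp hPμ.2.1 hPν.2.1 hstat hh]
  have habs : |∑ S, ν S * ∑ T, (Pμ S T - Pν S T) * (h T - h S)| ≤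
      ∑ S, ν S * ∑ T ∈ Finset.univ.erase S, |Pμ S T - Pν S T| * |h S - h T| := by
    refine (Finset.abs_sum_le_sum_abs _ _).trans (Finset.sum_le_sum fun S _ => ?_)
    rw [abs_mul, abs_of_nonneg (hν.1 S)]
    refine mul_le_mul_of_nonneg_left ?_ (hν.1 S)
    rw [← Finset.sum_erase (a := S) Finset.univ (by simp)]
    refine (Finset.abs_sum_le_sum_abs _ _).trans (Finset.sum_le_sum fun T _ => ?_)
    rw [abs_mul, abs_sub_comm (h T)]
  refine (ENNReal.ofReal_le_ofReal habs).trans ?_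
  have hnn : ∀ S T, 0 ≤ |Pμ S T - Pν S T| * |h S - h T| := fun S T => by positivity
  rw [ENNReal.ofReal_sum_of_nonneg fun S _ =>
    mul_nonneg (hν.1 S) (Finset.sum_nonneg fun T _ => hnn S T)]
  refine Finset.sum_le_sum fun S _ => ?_
  rw [ENNReal.ofReal_mul (hν.1 S)]
  by_cases hS : ν S = 0
  · simp [hS]
  refine mul_le_mul_right ?_ _
  rw [ENNReal.ofReal_sum_of_nonneg fun T _ => hnn S T]
  refine Finset.sum_le_sum fun T _ => ?_
  rw [ENNReal.ofReal_mul (abs_nonneg _)]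
  by_cases hT : μ T = 0
  · have h1 : Pμ S T = 0 := by
      by_contra hne
      exact hPμ.2.2.1 S (hsupp S hS) T hne hT
    have h2 : Pν S T = 0 := by
      by_contra hne
      exact hsupp T (hPν.2.2.1 S hS T hne) hT
    simp [h1, h2]
  · exact mul_le_mul_right (hcoup.poisson_le_tsum hPμ hf hK hhK hh (hsupp S hS) hT) _
end

section
/- Let μ be a probability distribution on a finite product space ∏_{v∈V} Ω(v) with |V| = n, and suppose the Glauber dynamics for μ is irreducible, aperiodic, and has discrete Ricci curvature α > 0 with respect to the Hamming distance on configurations. Then for every u ∈ V and c ∈ Ω(u) with Pr_{σ∼μ}[σ(u)=c] > 0: ∑_{v∈V} ∑_{c'∈Ω(v)} |Pr_{σ∼μ}[σ(v)=c' | σ(u)=c] − Pr_{σ∼μ}[σ(v)=c']| ≤ 4/(αn). -/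
open Finset

attribute [local instance] Classical.propDecidable

section ProductSpace

variable {V : Type*} [Fintype V] [DecidableEq V]
  {Ωv : V → Type*} [∀ v, Fintype (Ωv v)] [∀ v, DecidableEq (Ωv v)]

/-- `condMarg μ σ v c = μ^v(c ∣ σ_{-v})`: the conditional law at the coordinate `v` given the
values of `σ` off `v`. -/
noncomputable def condMarg (μ : (∀ v, Ωv v) → ℝ) (σ : ∀ v, Ωv v) (v : V) (c : Ωv v) : ℝ :=
  μ (Function.update σ v c) / ∑ c' : Ωv v, μ (Function.update σ v c')

/-- The Glauber dynamics (Gibbs sampler) for `μ`: pick a uniformly random coordinate `v` and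
resample it from the conditional law of `μ` given the other coordinates. -/
noncomputable def glauber (μ : (∀ v, Ωv v) → ℝ) :
    Matrix (∀ v, Ωv v) (∀ v, Ωv v) ℝ := fun σ τ =>
  (Fintype.card V : ℝ)⁻¹ *
    ∑ v : V, if ∀ w, w ≠ v → σ w = τ w then condMarg μ σ v (τ v) else 0

/-- Hamming distance between two configurations: the number of coordinates where they differ. -/
def hammConf (σ τ : ∀ v, Ωv v) : ℕ := (Finset.univ.filter fun v => σ v ≠ τ v).card

/-- `prV μ v c = Pr_{σ∼μ}[σ(v) = c]`. -/
noncomputable def prV (μ : (∀ v, Ωv v) → ℝ) (v : V) (c : Ωv v) : ℝ :=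
  ∑ σ : ∀ v, Ωv v, if σ v = c then μ σ else 0

/-- `prVV μ u c v c' = Pr_{σ∼μ}[σ(u) = c ∧ σ(v) = c']`. -/
noncomputable def prVV (μ : (∀ v, Ωv v) → ℝ) (u : V) (c : Ωv u) (v : V) (c' : Ωv v) : ℝ :=
  ∑ σ : ∀ v, Ωv v, if σ u = c ∧ σ v = c' then μ σ else 0

end ProductSpace

section GlauberInfluence

variable {V : Type*} [Fintype V] [DecidableEq V]
  {Ωv : V → Type*} [∀ v, Fintype (Ωv v)] [∀ v, DecidableEq (Ωv v)]

/-- The average of `f` after resampling the coordinate `v` of `σ` from its conditional law. -/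
noncomputable def siteAvg (μ : (∀ v, Ωv v) → ℝ) (v : V) (f : (∀ v, Ωv v) → ℝ)
    (σ : ∀ v, Ωv v) : ℝ :=
  ∑ c : Ωv v, condMarg μ σ v c * f (Function.update σ v c)

theorem glauber_sum_eq (μ f : (∀ v, Ωv v) → ℝ) (σ : ∀ v, Ωv v) :
    ∑ a, glauber μ σ a * f a = (Fintype.card V : ℝ)⁻¹ * ∑ v, siteAvg μ v f σ := by
  have h : ∀ v : V, ∑ a : ∀ v, Ωv v,
      (if ∀ w, w ≠ v → σ w = a w then condMarg μ σ v (a v) else 0) * f a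
        = siteAvg μ v f σ := by
    intro v
    simp only [ite_mul, zero_mul]
    rw [← Finset.sum_filter]
    refine Finset.sum_nbij' (fun a => a v) (fun c => Function.update σ v c) ?_ ?_ ?_ ?_ ?_
    · simp
    · intro c _
      simp only [Finset.mem_filter, Finset.mem_univ, true_and]
      intro w hw
      simp [hw]
    · intro a ha
      simp only [Finset.mem_filter, Finset.mem_univ, true_and] at ha
      funext w
      by_cases hw : w = v
      · subst hw; simp
      · simp [hw, ha w hw]
    · simp
    · intro a ha
      simp only [Finset.mem_filter, Finset.mem_univ, true_and] at ha
      have : Function.update σ v (a v) = a := by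
        funext w
        by_cases hw : w = v
        · subst hw; simp
        · simp [hw, ha w hw]
      rw [this]
  simp only [glauber, mul_assoc, ← Finset.mul_sum, Finset.sum_mul]
  rw [Finset.sum_comm]
  simp only [h]

omit [∀ v, Fintype (Ωv v)] in
theorem hammConf_update_le_one (σ : ∀ v, Ωv v) (v : V) (c : Ωv v) :
    hammConf σ (Function.update σ v c) ≤ 1 := by
  unfold hammConf
  refine (Finset.card_le_card (t := {v}) ?_).trans (by simp)
  intro w hw
  simp only [Finset.mem_filter, Finset.mem_univ, true_and] at hw
  by_contra h
  simp only [Finset.mem_singleton] at h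
  exact hw (by simp [h])

omit [DecidableEq V] [∀ v, Fintype (Ωv v)] in
theorem hammConf_pos {σ τ : ∀ v, Ωv v} (h : σ ≠ τ) : 0 < hammConf σ τ := by
  obtain ⟨v, hv⟩ := Function.ne_iff.mp h
  exact Finset.card_pos.mpr ⟨v, by simpa using hv⟩

omit [DecidableEq V] [∀ v, Fintype (Ωv v)] in
theorem hammConf_le_card (σ τ : ∀ v, Ωv v) : hammConf σ τ ≤ Fintype.card V :=
  Finset.card_le_univ _

omit [Fintype V] [∀ v, DecidableEq (Ωv v)] in
theorem sum_update_pos {μ : (∀ v, Ωv v) → ℝ} (hμ : ∀ x, 0 ≤ μ x) {σ : ∀ v, Ωv v}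
    (hσ : μ σ ≠ 0) (v : V) : 0 < ∑ c : Ωv v, μ (Function.update σ v c) := by
  refine Finset.sum_pos' (fun c _ => hμ _) ⟨σ v, Finset.mem_univ _, ?_⟩
  rw [Function.update_eq_self]
  exact lt_of_le_of_ne (hμ σ) (Ne.symm hσ)

omit [Fintype V] [∀ v, DecidableEq (Ωv v)] in
theorem sum_condMarg {μ : (∀ v, Ωv v) → ℝ} (hμ : ∀ x, 0 ≤ μ x) {σ : ∀ v, Ωv v}
    (hσ : μ σ ≠ 0) (v : V) : ∑ c : Ωv v, condMarg μ σ v c = 1 := by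
  unfold condMarg
  rw [← Finset.sum_div]
  exact div_self (sum_update_pos hμ hσ v).ne'

omit [Fintype V] [∀ v, DecidableEq (Ωv v)] in
theorem condMarg_nonneg {μ : (∀ v, Ωv v) → ℝ} (hμ : ∀ x, 0 ≤ μ x) (σ : ∀ v, Ωv v)
    (v : V) (c : Ωv v) : 0 ≤ condMarg μ σ v c :=
  div_nonneg (hμ _) (Finset.sum_nonneg fun _ _ => hμ _)

omit [∀ v, DecidableEq (Ωv v)] in
/-- Resampling the coordinate `v` preserves every measure whose density with respect to `μ` does
not depend on that coordinate. -/
theorem sum_mul_siteAvg {μ : (∀ v, Ωv v) → ℝ} (hμ : ∀ x, 0 ≤ μ x) (v : V)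
    (g : (∀ v, Ωv v) → ℝ) (hg : ∀ σ (c : Ωv v), g (Function.update σ v c) = g σ)
    (f : (∀ v, Ωv v) → ℝ) :
    ∑ σ, g σ * μ σ * siteAvg μ v f σ = ∑ σ, g σ * μ σ * f σ := by
  let e : (∀ v, Ωv v) × Ωv v → (∀ v, Ωv v) × Ωv v :=
    fun p => (Function.update p.1 v p.2, p.1 v)
  have he : Function.Involutive e := by
    rintro ⟨σ, c⟩
    simp [e]
  have h1 : ∑ σ, g σ * μ σ * siteAvg μ v f σ
      = ∑ p : (∀ v, Ωv v) × Ωv v,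
        g p.1 * μ p.1 * (condMarg μ p.1 v p.2 * f (Function.update p.1 v p.2)) := by
    rw [Fintype.sum_prod_type]
    simp only [siteAvg, Finset.mul_sum]
  rw [h1, ← Equiv.sum_comp he.toPerm, Fintype.sum_prod_type]
  refine Finset.sum_congr rfl fun σ _ => ?_
  by_cases hσ : μ σ = 0
  · simp [e, condMarg, hσ]
  · have h2 : ∀ c : Ωv v, g (Function.update σ v c) * μ (Function.update σ v c) *
        (condMarg μ (Function.update σ v c) v (σ v) * f σ)
        = g σ * μ σ * f σ * condMarg μ σ v c := by
      intro c
      simp only [condMarg, hg, Function.update_idem, Function.update_eq_self]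
      ring
    simp only [Function.Involutive.coe_toPerm, e, Function.update_idem, Function.update_eq_self]
    simp only [h2]
    rw [← Finset.mul_sum, sum_condMarg hμ hσ, mul_one]

theorem sub_siteAvg_le {μ : (∀ v, Ωv v) → ℝ} (hμ : ∀ x, 0 ≤ μ x) {σ : ∀ v, Ωv v}
    (hσ : μ σ ≠ 0) (v : V) {L : ℝ} (hL : 0 ≤ L) {f : (∀ v, Ωv v) → ℝ}
    (hf : ∀ a b, |f a - f b| ≤ L * hammConf a b) : f σ - siteAvg μ v f σ ≤ L := by
  have h1 : f σ - siteAvg μ v f σ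
      = ∑ c : Ωv v, condMarg μ σ v c * (f σ - f (Function.update σ v c)) := by
    simp only [mul_sub, Finset.sum_sub_distrib, ← Finset.sum_mul, sum_condMarg hμ hσ v, one_mul,
      siteAvg]
  calc f σ - siteAvg μ v f σ
      = ∑ c : Ωv v, condMarg μ σ v c * (f σ - f (Function.update σ v c)) := h1
    _ ≤ ∑ c : Ωv v, condMarg μ σ v c * L := by
        refine Finset.sum_le_sum fun c _ =>
          mul_le_mul_of_nonneg_left ?_ (condMarg_nonneg hμ σ v c)
        have h2 : (hammConf σ (Function.update σ v c) : ℝ) ≤ 1 := by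
          exact_mod_cast hammConf_update_le_one σ v c
        exact (le_abs_self _).trans ((hf _ _).trans (mul_le_of_le_one_right hL h2))
    _ = L := by rw [← Finset.sum_mul, sum_condMarg hμ hσ v, one_mul]

theorem sum_mul_glauber {μ : (∀ v, Ωv v) → ℝ} (hμ : ∀ x, 0 ≤ μ x) [Nonempty V]
    (f : (∀ v, Ωv v) → ℝ) :
    ∑ σ, μ σ * ∑ a, glauber μ σ a * f a = ∑ σ, μ σ * f σ := by
  have h : ∀ v : V, ∑ σ, μ σ * siteAvg μ v f σ = ∑ σ, μ σ * f σ := fun v => by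
    simpa using sum_mul_siteAvg hμ v (fun _ => 1) (fun _ _ => rfl) f
  have h1 : ∑ σ, μ σ * ∑ a, glauber μ σ a * f a
      = (Fintype.card V : ℝ)⁻¹ * ∑ v, ∑ σ, μ σ * siteAvg μ v f σ := by
    rw [Finset.sum_comm, Finset.mul_sum]
    refine Finset.sum_congr rfl fun σ _ => ?_
    rw [glauber_sum_eq, ← Finset.mul_sum]
    ring
  rw [h1]
  simp [h]

/-- One Glauber step barely moves a probability measure whose density with respect to `μ`
depends only on the coordinate `u`. -/
theorem sum_mul_sub_glauber_le {μ : (∀ v, Ωv v) → ℝ} (hμ : ∀ x, 0 ≤ μ x) [Nonempty V] (u : V)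
    (g : (∀ v, Ωv v) → ℝ) (hg0 : ∀ σ, 0 ≤ g σ) (hg1 : ∑ σ, g σ * μ σ = 1)
    (hg : ∀ v, v ≠ u → ∀ σ (c : Ωv v), g (Function.update σ v c) = g σ)
    {L : ℝ} (hL : 0 ≤ L) {f : (∀ v, Ωv v) → ℝ}
    (hf : ∀ a b, |f a - f b| ≤ L * hammConf a b) :
    ∑ σ, g σ * μ σ * f σ - ∑ σ, g σ * μ σ * ∑ a, glauber μ σ a * f a
      ≤ L * (Fintype.card V : ℝ)⁻¹ := by
  have hn : (Fintype.card V : ℝ) ≠ 0 := by simp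
  have h1 : ∑ σ, g σ * μ σ * f σ - ∑ σ, g σ * μ σ * ∑ a, glauber μ σ a * f a
      = (Fintype.card V : ℝ)⁻¹ * ∑ v, ∑ σ, g σ * μ σ * (f σ - siteAvg μ v f σ) := by
    rw [Finset.sum_comm, Finset.mul_sum, ← Finset.sum_sub_distrib]
    refine Finset.sum_congr rfl fun σ _ => ?_
    rw [glauber_sum_eq, ← Finset.mul_sum, Finset.sum_sub_distrib]
    simp only [Finset.sum_const, Finset.card_univ, nsmul_eq_mul]
    field_simp
  have h2 : ∑ v, ∑ σ, g σ * μ σ * (f σ - siteAvg μ v f σ)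
      = ∑ σ, g σ * μ σ * (f σ - siteAvg μ u f σ) := by
    refine Finset.sum_eq_single u (fun v _ hv => ?_) (by simp)
    simp only [mul_sub, Finset.sum_sub_distrib]
    rw [sum_mul_siteAvg hμ v g (hg v hv) f, sub_self]
  have h3 : ∑ σ, g σ * μ σ * (f σ - siteAvg μ u f σ) ≤ L := by
    calc _ ≤ ∑ σ, g σ * μ σ * L := by
          refine Finset.sum_le_sum fun σ _ => ?_
          by_cases hσ : μ σ = 0
          · simp [hσ]
          · exact mul_le_mul_of_nonneg_left (sub_siteAvg_le hμ hσ u hL hf)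
              (mul_nonneg (hg0 σ) (hμ σ))
      _ = L := by rw [← Finset.sum_mul, hg1, one_mul]
  rw [h1, h2, mul_comm]
  exact mul_le_mul_of_nonneg_right h3 (by positivity)

theorem expect_sub_le_of_lipschitz {μ ν : (∀ v, Ωv v) → ℝ} (hμ : IsProbDist μ)
    (hν : IsProbDist ν) {L : ℝ} (hL : 0 ≤ L) {f : (∀ v, Ωv v) → ℝ}
    (hf : ∀ a b, |f a - f b| ≤ L * hammConf a b) :
    ∑ σ, ν σ * f σ - ∑ σ, μ σ * f σ ≤ L * Fintype.card V := by
  have h1 : ∑ σ, ν σ * f σ - ∑ τ, μ τ * f τ = ∑ σ, ∑ τ, ν σ * μ τ * (f σ - f τ) := by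
    have e1 : ∑ σ, ν σ * f σ = ∑ σ, ∑ τ, ν σ * μ τ * f σ := by
      refine Finset.sum_congr rfl fun σ _ => ?_
      rw [← Finset.sum_mul, ← Finset.mul_sum, hμ.2, mul_one]
    have e2 : ∑ τ, μ τ * f τ = ∑ σ, ∑ τ, ν σ * μ τ * f τ := by
      rw [Finset.sum_comm]
      refine Finset.sum_congr rfl fun τ _ => ?_
      rw [← Finset.sum_mul, ← Finset.sum_mul, hν.2, one_mul]
    rw [e1, e2]
    simp only [mul_sub, Finset.sum_sub_distrib]
  have h2 : ∀ σ τ, f σ - f τ ≤ L * Fintype.card V := fun σ τ =>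
    (le_abs_self _).trans ((hf σ τ).trans (mul_le_mul_of_nonneg_left
      (by exact_mod_cast hammConf_le_card σ τ) hL))
  rw [h1]
  calc _ ≤ ∑ σ, ∑ τ, ν σ * μ τ * (L * Fintype.card V) :=
        Finset.sum_le_sum fun σ _ => Finset.sum_le_sum fun τ _ =>
          mul_le_mul_of_nonneg_left (h2 σ τ) (mul_nonneg (hν.1 σ) (hμ.1 τ))
    _ = L * Fintype.card V := by
        simp only [← Finset.sum_mul, ← Finset.mul_sum, hμ.2, hν.2, one_mul, mul_one]

/-- Positive curvature bounds the Wasserstein distance to `μ` of a probability measure whose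
density with respect to `μ` depends only on the coordinate `u`. -/
theorem expect_sub_le_of_curvature {μ : (∀ v, Ωv v) → ℝ} (hμ : IsProbDist μ) [Nonempty V]
    {α : ℝ} (hα : 0 < α)
    (hcurv : ∀ σ τ : ∀ v, Ωv v, σ ≠ τ →
      ∀ f : (∀ v, Ωv v) → ℝ, (∀ a b, |f a - f b| ≤ (hammConf a b : ℝ)) →
        |(∑ a, glauber μ σ a * f a) - ∑ a, glauber μ τ a * f a|
          ≤ (1 - α) * (hammConf σ τ : ℝ))
    (u : V) (g : (∀ v, Ωv v) → ℝ) (hg0 : ∀ σ, 0 ≤ g σ) (hg1 : ∑ σ, g σ * μ σ = 1)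
    (hg : ∀ v, v ≠ u → ∀ σ (c : Ωv v), g (Function.update σ v c) = g σ)
    {L : ℝ} (hL : 0 ≤ L) {f : (∀ v, Ωv v) → ℝ}
    (hf : ∀ a b, |f a - f b| ≤ L * hammConf a b) :
    ∑ σ, g σ * μ σ * f σ - ∑ σ, μ σ * f σ ≤ L / (α * Fintype.card V) := by
  have hn : (0 : ℝ) < Fintype.card V := by exact_mod_cast Fintype.card_pos
  have hν : IsProbDist (fun σ => g σ * μ σ) := ⟨fun σ => mul_nonneg (hg0 σ) (hμ.1 σ), hg1⟩
  rcases le_or_gt α 1 with hα1 | hα1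
  · have key : ∀ (k : ℕ) (L : ℝ), 0 ≤ L → ∀ f : (∀ v, Ωv v) → ℝ,
        (∀ a b, |f a - f b| ≤ L * hammConf a b) →
        ∑ σ, g σ * μ σ * f σ - ∑ σ, μ σ * f σ
          ≤ L * (1 / (α * Fintype.card V) + (1 - α) ^ k * Fintype.card V) := by
      intro k
      induction k with
      | zero =>
        intro L hL f hf
        refine (expect_sub_le_of_lipschitz hμ hν hL hf).trans ?_
        refine mul_le_mul_of_nonneg_left ?_ hL
        have : 0 ≤ 1 / (α * (Fintype.card V : ℝ)) := by positivity
        simpa using this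
      | succ k ih =>
        intro L hL f hf
        rcases hL.eq_or_lt with rfl | hLpos
        · simpa using expect_sub_le_of_lipschitz hμ hν le_rfl hf
        have hPf : ∀ a b, |(∑ x, glauber μ a x * f x) - ∑ x, glauber μ b x * f x|
            ≤ ((1 - α) * L) * hammConf a b := by
          intro a b
          rcases eq_or_ne a b with rfl | hab
          · simp [hammConf]
          have h := hcurv a b hab (fun x => f x / L) (fun x y => by
            rw [← sub_div, abs_div, abs_of_pos hLpos, div_le_iff₀ hLpos, mul_comm]
            exact hf x y)
          simp only [← mul_div_assoc, ← Finset.sum_div] at h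
          rw [← sub_div, abs_div, abs_of_pos hLpos, div_le_iff₀ hLpos] at h
          linarith
        have h1 := ih ((1 - α) * L) (mul_nonneg (by linarith) hL) _ hPf
        have h2 := sum_mul_sub_glauber_le hμ.1 u g hg0 hg1 hg hL hf
        rw [sum_mul_glauber hμ.1 f] at h1
        have h3 : L * (1 / (α * Fintype.card V) + (1 - α) ^ (k + 1) * Fintype.card V)
            = L * (Fintype.card V : ℝ)⁻¹ + (1 - α) * L *
              (1 / (α * Fintype.card V) + (1 - α) ^ k * Fintype.card V) := by
          field_simp
          ring
        rw [h3]
        linarith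
    have hlim : Filter.Tendsto
        (fun k : ℕ => L * (1 / (α * Fintype.card V) + (1 - α) ^ k * Fintype.card V))
        Filter.atTop (nhds (L * (1 / (α * Fintype.card V) + 0 * Fintype.card V))) :=
      (((tendsto_pow_atTop_nhds_zero_of_lt_one (by linarith) (by linarith)).mul_const
        _).const_add _).const_mul _
    have h := ge_of_tendsto' hlim fun k => key k L hL f hf
    rwa [zero_mul, add_zero, mul_one_div] at h
  · have hsub : ∀ a b : ∀ v, Ωv v, a = b := by
      intro a b
      by_contra hab
      have h := hcurv a b hab (fun _ => 0) (by simp)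
      have hpos : (0 : ℝ) < hammConf a b := by exact_mod_cast hammConf_pos hab
      simp only [mul_zero, Finset.sum_const_zero, sub_zero, abs_zero] at h
      nlinarith
    have h := expect_sub_le_of_lipschitz hμ hν le_rfl (f := f) (fun a b => by
      rw [hsub a b]; simp)
    rw [zero_mul] at h
    exact h.trans (by positivity)

omit [DecidableEq V] [∀ v, Fintype (Ωv v)] in
theorem abs_sum_sub_sum_le (s : ∀ v, Ωv v → ℝ) (hs : ∀ v c, |s v c| ≤ 1) (a b : ∀ v, Ωv v) :
    |∑ v, s v (a v) - ∑ v, s v (b v)| ≤ 2 * hammConf a b := by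
  rw [← Finset.sum_sub_distrib]
  calc _ ≤ ∑ v, |s v (a v) - s v (b v)| := Finset.abs_sum_le_sum_abs _ _
    _ ≤ ∑ v, (if a v ≠ b v then (2 : ℝ) else 0) := by
        refine Finset.sum_le_sum fun v _ => ?_
        split_ifs with h
        · have := abs_sub (s v (a v)) (s v (b v))
          linarith [hs v (a v), hs v (b v)]
        · rw [not_not.mp h]; simp
    _ = 2 * hammConf a b := by
        rw [← Finset.sum_filter, Finset.sum_const, nsmul_eq_mul, mul_comm, hammConf]

theorem sum_mul_prV (μ : (∀ v, Ωv v) → ℝ) (s : ∀ v, Ωv v → ℝ) :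
    ∑ v, ∑ c, s v c * prV μ v c = ∑ σ, μ σ * ∑ v, s v (σ v) := by
  simp only [prV, Finset.mul_sum]
  rw [Finset.sum_comm (s := (univ : Finset (∀ v, Ωv v)))]
  refine Finset.sum_congr rfl fun v _ => ?_
  rw [Finset.sum_comm]
  refine Finset.sum_congr rfl fun σ _ => ?_
  simp [mul_comm]

end GlauberInfluence

/-- positive discrete Ricci curvature of the Glauber dynamics implies
spectral independence.  Let `μ` be a probability distribution on a finite product space
`∏_{v∈V} Ω(v)` with `|V| = n` whose Glauber dynamics is irreducible and aperiodic and has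
discrete Ricci curvature `α > 0` w.r.t. Hamming distance, i.e. for every pair `σ ≠ τ` the
1-Wasserstein distance between the transition rows satisfies
`W₁(P(σ,·), P(τ,·)) ≤ (1−α)·d_H(σ,τ)` (expressed via all 1-Lipschitz test functions).
Then for every `u ∈ V` and `c ∈ Ω(u)` with `Pr_{σ∼μ}[σ(u)=c] > 0`,
`∑_{v∈V} ∑_{c'∈Ω(v)} |Pr[σ(v)=c' ∣ σ(u)=c] − Pr[σ(v)=c']| ≤ 4/(αn)`. -/
theorem curvature_implies_influence_bound
    {V : Type*} [Fintype V] [DecidableEq V]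
    {Ωv : V → Type*} [∀ v, Fintype (Ωv v)] [∀ v, DecidableEq (Ωv v)]
    (μ : (∀ v, Ωv v) → ℝ) (hμ : IsProbDist μ)
    (hirr : IrreducibleOn (glauber μ) Set.univ)
    (haper : AperiodicOn (glauber μ) Set.univ)
    (α : ℝ) (hα : 0 < α)
    (hcurv : ∀ σ τ : ∀ v, Ωv v, σ ≠ τ →
      ∀ f : (∀ v, Ωv v) → ℝ, (∀ a b, |f a - f b| ≤ (hammConf a b : ℝ)) →
        |(∑ a, glauber μ σ a * f a) - ∑ a, glauber μ τ a * f a|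
          ≤ (1 - α) * (hammConf σ τ : ℝ)) :
    ∀ (u : V) (c : Ωv u), 0 < prV μ u c →
      ∑ v : V, ∑ c' : Ωv v, |prVV μ u c v c' / prV μ u c - prV μ v c'|
        ≤ 4 / (α * Fintype.card V) := by
  intro u c hpos
  have : Nonempty V := ⟨u⟩
  set g : (∀ v, Ωv v) → ℝ := fun σ => if σ u = c then 1 / prV μ u c else 0 with hgdef
  have hg0 : ∀ σ, 0 ≤ g σ := by
    intro σ
    simp only [hgdef]
    split_ifs <;> positivity
  have hg1 : ∑ σ, g σ * μ σ = 1 := by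
    have h : ∀ σ, g σ * μ σ = (if σ u = c then μ σ else 0) / prV μ u c := by
      intro σ
      simp only [hgdef]
      split_ifs <;> ring
    simp only [h]
    rw [← Finset.sum_div]
    exact div_self hpos.ne'
  have hg : ∀ v, v ≠ u → ∀ σ (c : Ωv v), g (Function.update σ v c) = g σ := by
    intro v hv σ c
    simp [hgdef, hv.symm]
  have hcond : ∀ v c', prVV μ u c v c' / prV μ u c = prV (fun σ => g σ * μ σ) v c' := by
    intro v c'
    refine (Finset.sum_div _ _ _).trans (Finset.sum_congr rfl fun σ _ => ?_)
    by_cases h1 : σ u = c <;> by_cases h2 : σ v = c' <;> simp [hgdef, h1, h2, div_eq_inv_mul]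
  let s : ∀ v, Ωv v → ℝ := fun v c' =>
    if 0 ≤ prV (fun σ => g σ * μ σ) v c' - prV μ v c' then 1 else -1
  have hs : ∀ v c', |s v c'| ≤ 1 := by
    intro v c'
    simp only [s]
    split_ifs <;> simp
  have habs : ∀ v c', |prVV μ u c v c' / prV μ u c - prV μ v c'|
      = s v c' * prV (fun σ => g σ * μ σ) v c' - s v c' * prV μ v c' := by
    intro v c'
    rw [hcond, ← mul_sub]
    simp only [s]
    split_ifs with h
    · rw [abs_of_nonneg h, one_mul]
    · rw [abs_of_neg (not_le.mp h), neg_one_mul]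
  simp only [habs, Finset.sum_sub_distrib]
  rw [sum_mul_prV, sum_mul_prV]
  refine (expect_sub_le_of_curvature hμ hα hcurv u g hg0 hg1 hg zero_le_two
    (abs_sum_sub_sum_le s hs)).trans ?_
  gcongr
  norm_num
end

section
/- Fix a list-coloring instance (G, L) with n vertices and maximum degree Δ, and flip parameters p_j ∈ [0,1] with p_j = 0 for all j ≥ 7. Fix a vertex u and a color c ∈ L(u) such that there exists a proper list-coloring assigning c to u, and let P_{μ,flip} be the flip dynamics for the uniform distribution μ over proper list-colorings of (G,L), and P_{μ|uc,flip} be the flip dynamics (with the same flip parameters) for the conditional distribution μ|uc, viewed as a chain on proper list-colorings τ with τ(u)=c. Then for every proper list-coloring τ with τ(u) = c: ∑_{σ≠τ} |P_{μ,flip}(τ→σ) − P_{μ|uc,flip}(τ→σ)| ≤ (|B(u,6)| + 1)/n, where B(u,6) = {v ∈ V : dist_G(u,v) ≤ 6} is the ball of radius 6 around u (so |B(u,6)| ≤ 1 + Δ + Δ² + … + Δ⁶). -/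
open Finset

attribute [local instance] Classical.propDecidable

section ListColoring

variable {V : Type*} [Fintype V] [DecidableEq V] {q : ℕ}

/-- `σ` is a proper list-coloring of the instance `(G, L)`. -/
def IsProperListColoring (G : SimpleGraph V) (L : V → Finset (Fin q)) (σ : V → Fin q) : Prop :=
  (∀ v, σ v ∈ L v) ∧ ∀ u v, G.Adj u v → σ u ≠ σ v

/-- One step of an alternating path inside the active vertex set `Vs`, using only the two
colors `a` and `b`. -/
def kempeStep (G : SimpleGraph V) (Vs : Finset V) (σ : V → Fin q) (a b : Fin q)
    (w w' : V) : Prop :=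
  w ∈ Vs ∧ w' ∈ Vs ∧ G.Adj w w' ∧ (σ w = a ∨ σ w = b) ∧ (σ w' = a ∨ σ w' = b) ∧ σ w ≠ σ w'

/-- The Kempe component `S_σ(u,c)` (within the active vertex set `Vs`): all vertices reachable
from `u` along an alternating path using the colors `σ u` and `c`. -/
noncomputable def kempeComp (G : SimpleGraph V) (Vs : Finset V) (σ : V → Fin q)
    (u : V) (c : Fin q) : Finset V :=
  Finset.univ.filter fun v => Relation.ReflTransGen (kempeStep G Vs σ (σ u) c) u v

/-- The coloring obtained from `σ` by interchanging the colors `a` and `b` on `S`. -/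
def flipConf (σ : V → Fin q) (a b : Fin q) (S : Finset V) : V → Fin q := fun v =>
  if v ∈ S then (if σ v = a then b else if σ v = b then a else σ v) else σ v

/-- The flip dynamics with flip parameters `p`: pick a uniformly random active vertex
`v ∈ Vs` and a uniformly random color `c` from the pick-list `Lpick v`; if the Kempe
component `S = S_σ(v,c)` (within `Vs`) is flippable (i.e. the flipped coloring is a proper
list-coloring for `(G, L)`), flip it with probability `p |S| / |S|`, otherwise stay. -/
noncomputable def flipMatrix (G : SimpleGraph V) (Vs : Finset V)
    (Lpick L : V → Finset (Fin q)) (p : ℕ → ℝ) :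
    Matrix (V → Fin q) (V → Fin q) ℝ := fun σ τ =>
  (Vs.card : ℝ)⁻¹ * ∑ v ∈ Vs, ((Lpick v).card : ℝ)⁻¹ * ∑ c ∈ Lpick v,
    ((if IsProperListColoring G L (flipConf σ (σ v) c (kempeComp G Vs σ v c)) ∧
          τ = flipConf σ (σ v) c (kempeComp G Vs σ v c)
        then p (kempeComp G Vs σ v c).card / ((kempeComp G Vs σ v c).card : ℝ) else 0) +
      (if τ = σ then
          1 - (if IsProperListColoring G L (flipConf σ (σ v) c (kempeComp G Vs σ v c))
              then p (kempeComp G Vs σ v c).card / ((kempeComp G Vs σ v c).card : ℝ) else 0)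
        else 0))

end ListColoring

theorem mem_kempeComp {V : Type*} [Fintype V] {q : ℕ} {G : SimpleGraph V} {Vs : Finset V}
    {σ : V → Fin q} {v x : V} {d : Fin q} :
    x ∈ kempeComp G Vs σ v d ↔ Relation.ReflTransGen (kempeStep G Vs σ (σ v) d) v x := by
  simp [kempeComp]

section FlipDynamicsComparison

variable {V : Type*} [Fintype V] [DecidableEq V] {q : ℕ}

/-- The probability mass that the flip dynamics moves from `σ` to `τ` by flipping the Kempe
component of `v` and `d`, once the pair `(v, d)` has been picked. -/
noncomputable def flipWeight (G : SimpleGraph V) (Vs : Finset V) (L : V → Finset (Fin q))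
    (p : ℕ → ℝ) (σ : V → Fin q) (v : V) (d : Fin q) (τ : V → Fin q) : ℝ :=
  if IsProperListColoring G L (flipConf σ (σ v) d (kempeComp G Vs σ v d)) ∧
      τ = flipConf σ (σ v) d (kempeComp G Vs σ v d)
    then p (kempeComp G Vs σ v d).card / ((kempeComp G Vs σ v d).card : ℝ) else 0

theorem flipMatrix_apply_of_ne {G : SimpleGraph V} {Vs : Finset V} {Lpick L : V → Finset (Fin q)}
    {p : ℕ → ℝ} {σ τ : V → Fin q} (h : τ ≠ σ) :
    flipMatrix G Vs Lpick L p σ τ = (Vs.card : ℝ)⁻¹ *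
      ∑ v ∈ Vs, ((Lpick v).card : ℝ)⁻¹ * ∑ d ∈ Lpick v, flipWeight G Vs L p σ v d τ := by
  simp [flipMatrix, flipWeight, h]

theorem flipWeight_nonneg {G : SimpleGraph V} {Vs : Finset V} {L : V → Finset (Fin q)}
    {p : ℕ → ℝ} (hp : ∀ j, 0 ≤ p j) (σ : V → Fin q) (v : V) (d : Fin q) (τ : V → Fin q) :
    0 ≤ flipWeight G Vs L p σ v d τ := by
  unfold flipWeight
  split_ifs
  · exact div_nonneg (hp _) (Nat.cast_nonneg _)
  · exact le_rfl

theorem sum_flipWeight_le_one {G : SimpleGraph V} {Vs : Finset V} {L : V → Finset (Fin q)}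
    {p : ℕ → ℝ} (hp : ∀ j, 0 ≤ p j ∧ p j ≤ 1) (σ : V → Fin q) (v : V) (d : Fin q)
    (T : Finset (V → Fin q)) :
    ∑ τ ∈ T, flipWeight G Vs L p σ v d τ ≤ 1 := by
  set S := kempeComp G Vs σ v d with hS
  have hcard : (1 : ℝ) ≤ S.card := by
    have : 0 < S.card := Finset.card_pos.2 ⟨v, mem_kempeComp.2 Relation.ReflTransGen.refl⟩
    exact_mod_cast this
  have hq : p S.card / (S.card : ℝ) ≤ 1 :=
    div_le_one_of_le₀ ((hp _).2.trans hcard) (by positivity)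
  have hq0 : 0 ≤ p S.card / (S.card : ℝ) := div_nonneg (hp _).1 (by positivity)
  calc ∑ τ ∈ T, flipWeight G Vs L p σ v d τ
      ≤ ∑ τ ∈ T, if τ = flipConf σ (σ v) d S then p S.card / (S.card : ℝ) else 0 := by
        refine Finset.sum_le_sum fun τ _ => ?_
        unfold flipWeight
        rw [← hS]
        by_cases h : τ = flipConf σ (σ v) d S
        · simp only [h, and_true, if_true]
          split_ifs <;> simp [hq0]
        · simp [h]
    _ ≤ 1 := by
        rw [Finset.sum_ite_eq']
        split_ifs
        · exact hq
        · exact zero_le_one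

/-- Deleting a vertex outside a Kempe component does not change the component. -/
theorem kempeComp_erase_of_notMem {G : SimpleGraph V} {σ : V → Fin q} {u v : V} {d : Fin q}
    (h : u ∉ kempeComp G Finset.univ σ v d) :
    kempeComp G (Finset.univ.erase u) σ v d = kempeComp G Finset.univ σ v d := by
  rw [mem_kempeComp] at h
  ext x
  rw [mem_kempeComp, mem_kempeComp]
  constructor
  · have hle : kempeStep G (Finset.univ.erase u) σ (σ v) d ≤ kempeStep G Finset.univ σ (σ v) d :=
      fun a b hab => ⟨mem_univ _, mem_univ _, hab.2.2⟩
    exact Relation.ReflTransGen.mono hle v x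
  · intro hx
    induction hx with
    | refl => exact Relation.ReflTransGen.refl
    | tail hvb hbc ih =>
      refine ih.tail ⟨?_, ?_, hbc.2.2⟩
      · refine mem_erase.2 ⟨?_, mem_univ _⟩
        rintro rfl
        exact h hvb
      · refine mem_erase.2 ⟨?_, mem_univ _⟩
        rintro rfl
        exact h (hvb.tail hbc)

theorem ne_of_mem_kempeComp_erase {G : SimpleGraph V} {σ : V → Fin q} {u v x : V} {d : Fin q}
    (hv : v ≠ u) (h : x ∈ kempeComp G (Finset.univ.erase u) σ v d) : x ≠ u := by
  rw [mem_kempeComp] at h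
  cases h with
  | refl => exact hv
  | tail _ hbc => exact (mem_erase.1 hbc.2.1).1

/-- If the Kempe component of `v` contains `u ≠ v`, then after deleting `u` it contains a vertex
from which `u` was reached in one step. -/
theorem exists_mem_kempeComp_erase_kempeStep {G : SimpleGraph V} {σ : V → Fin q} {u v : V}
    {d : Fin q} (hv : v ≠ u) (h : u ∈ kempeComp G Finset.univ σ v d) :
    ∃ w ∈ kempeComp G (Finset.univ.erase u) σ v d, kempeStep G Finset.univ σ (σ v) d w u := by
  rw [mem_kempeComp] at h
  have key : ∀ x, Relation.ReflTransGen (kempeStep G Finset.univ σ (σ v) d) v x →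
      x ∈ kempeComp G (Finset.univ.erase u) σ v d ∨
      ∃ w ∈ kempeComp G (Finset.univ.erase u) σ v d,
        kempeStep G Finset.univ σ (σ v) d w u := by
    intro x hx
    induction hx with
    | refl => exact Or.inl (mem_kempeComp.2 Relation.ReflTransGen.refl)
    | @tail b y _ hby ih =>
      rcases ih with hb | hb
      · by_cases hy : y = u
        · subst hy
          exact Or.inr ⟨b, hb, hby⟩
        · exact Or.inl (mem_kempeComp.2 ((mem_kempeComp.1 hb).tail
            ⟨mem_erase.2 ⟨ne_of_mem_kempeComp_erase hv hb, mem_univ _⟩,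
              mem_erase.2 ⟨hy, mem_univ _⟩, hby.2.2⟩))
      · exact Or.inr hb
  rcases key u h with hu | hw
  · exact absurd rfl (ne_of_mem_kempeComp_erase hv hu)
  · exact hw

/-- A Kempe component that is cut off by freezing the color of `u` is not flippable. -/
theorem flipWeight_erase_eq_zero {G : SimpleGraph V} {L : V → Finset (Fin q)} {p : ℕ → ℝ}
    {σ : V → Fin q} {u v : V} {d : Fin q} (hv : v ≠ u)
    (h : u ∈ kempeComp G Finset.univ σ v d) (τ : V → Fin q) :
    flipWeight G (Finset.univ.erase u) L p σ v d τ = 0 := by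
  obtain ⟨w, hw, -, -, hadj, hσw, hσu, hne⟩ := exists_mem_kempeComp_erase_kempeStep hv h
  have hu : u ∉ kempeComp G (Finset.univ.erase u) σ v d := fun hu =>
    ne_of_mem_kempeComp_erase hv hu rfl
  refine if_neg fun hflip => hflip.1.2 w u hadj ?_
  simp only [flipConf, if_pos hw, if_neg hu]
  grind

theorem flipWeight_erase_eq_or {G : SimpleGraph V} {L : V → Finset (Fin q)} {p : ℕ → ℝ}
    {σ : V → Fin q} {u v : V} (hv : v ≠ u) (d : Fin q) :
    flipWeight G (Finset.univ.erase u) L p σ v d = flipWeight G Finset.univ L p σ v d ∨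
      flipWeight G (Finset.univ.erase u) L p σ v d = 0 := by
  by_cases h : u ∈ kempeComp G Finset.univ σ v d
  · exact Or.inr (funext fun τ => flipWeight_erase_eq_zero hv h τ)
  · left
    funext τ
    simp only [flipWeight, kempeComp_erase_of_notMem h]

/-- Any vertex of a Kempe component is within distance less than the size of the component. -/
theorem reachable_and_dist_lt_card_kempeComp {G : SimpleGraph V} {Vs : Finset V}
    {σ : V → Fin q} {v x : V} {d : Fin q} (h : x ∈ kempeComp G Vs σ v d) :
    G.Reachable x v ∧ G.dist x v < (kempeComp G Vs σ v d).card := by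
  let H : SimpleGraph V :=
    { Adj := kempeStep G Vs σ (σ v) d
      symm := ⟨fun a b hab => ⟨hab.2.1, hab.1, hab.2.2.1.symm, hab.2.2.2.2.1, hab.2.2.2.1,
        hab.2.2.2.2.2.symm⟩⟩
      loopless := ⟨fun a ha => ha.2.2.2.2.2 rfl⟩ }
  have hle : H ≤ G := fun a b hab => hab.2.2.1
  have hreach : ∀ y, H.Reachable v y ↔ y ∈ kempeComp G Vs σ v d := fun y => by
    rw [mem_kempeComp, SimpleGraph.reachable_iff_reflTransGen]
  obtain ⟨w, hw⟩ := ((hreach x).2 h).symm.exists_isPath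
  refine ⟨⟨w.mapLe hle⟩, ?_⟩
  have hdist : G.dist x v ≤ w.length := by
    simpa using SimpleGraph.dist_le (w.mapLe hle)
  have hsub : w.support.toFinset ⊆ kempeComp G Vs σ v d := by
    intro y hy
    exact (hreach y).1 ⟨(w.dropUntil y (List.mem_toFinset.1 hy)).reverse⟩
  have hcard := Finset.card_le_card hsub
  rw [List.toFinset_card_of_nodup hw.support_nodup, SimpleGraph.Walk.length_support] at hcard
  omega

theorem flipWeight_erase_eq_of_far {G : SimpleGraph V} {L : V → Finset (Fin q)} {p : ℕ → ℝ}
    {r : ℕ} (hpr : ∀ j, r < j → p j = 0) {σ : V → Fin q} {u v : V} (hv : v ≠ u)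
    (hfar : ¬ (G.Reachable u v ∧ G.dist u v ≤ r)) (d : Fin q) :
    flipWeight G (Finset.univ.erase u) L p σ v d = flipWeight G Finset.univ L p σ v d := by
  by_cases h : u ∈ kempeComp G Finset.univ σ v d
  · funext τ
    rw [flipWeight_erase_eq_zero hv h τ]
    obtain ⟨hr, hd⟩ := reachable_and_dist_lt_card_kempeComp h
    have : r < (kempeComp G Finset.univ σ v d).card := by
      by_contra hcon
      exact hfar ⟨hr, by omega⟩
    simp [flipWeight, hpr _ this]
  · funext τ
    simp only [flipWeight, kempeComp_erase_of_notMem h]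

end FlipDynamicsComparison

theorem sum_inv_card_mul_sum_le_one {ι Ω : Type*} (T : Finset Ω) (A : Finset ι)
    {f : ι → Ω → ℝ} (h : ∀ i, ∑ x ∈ T, f i x ≤ 1) :
    ∑ x ∈ T, (A.card : ℝ)⁻¹ * ∑ i ∈ A, f i x ≤ 1 := by
  rw [← Finset.mul_sum, Finset.sum_comm]
  calc (A.card : ℝ)⁻¹ * ∑ i ∈ A, ∑ x ∈ T, f i x ≤ (A.card : ℝ)⁻¹ * ∑ _i ∈ A, (1 : ℝ) := by
        gcongr with i
        exact h i
    _ ≤ 1 := by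
        rw [Finset.sum_const, nsmul_eq_mul, mul_one]
        exact inv_mul_le_one

/-- Comparison of two uniform mixtures of subprobability weights, the second of which is over a
subset of at least half the size and may lose some of its components. -/
theorem sum_abs_mixture_sub_le_one {ι Ω : Type*} [DecidableEq ι] (T : Finset Ω)
    {A A' : Finset ι} (hsub : A' ⊆ A) (hcard : A.card ≤ 2 * A'.card) {f g : ι → Ω → ℝ}
    (hf : ∀ i x, 0 ≤ f i x) (hf1 : ∀ i, ∑ x ∈ T, f i x ≤ 1) (hg : ∀ i, g i = f i ∨ g i = 0) :
    ∑ x ∈ T, |(A.card : ℝ)⁻¹ * ∑ i ∈ A, f i x - (A'.card : ℝ)⁻¹ * ∑ i ∈ A', g i x| ≤ 1 := by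
  have hcoef : |(A.card : ℝ)⁻¹ - (A'.card : ℝ)⁻¹| ≤ (A.card : ℝ)⁻¹ := by
    rcases Nat.eq_zero_or_pos A'.card with h0 | hpos
    · have : A.card = 0 := by omega
      simp [h0, this]
    · have hle : A'.card ≤ A.card := Finset.card_le_card hsub
      have hpos' : (0 : ℝ) < A'.card := by exact_mod_cast hpos
      have hposA : (0 : ℝ) < A.card := by exact_mod_cast hpos.trans_le hle
      have hcard' : (A.card : ℝ) ≤ 2 * A'.card := by exact_mod_cast hcard
      have h1 : (A.card : ℝ)⁻¹ ≤ (A'.card : ℝ)⁻¹ := by gcongr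
      have h2 : (A'.card : ℝ)⁻¹ ≤ 2 * (A.card : ℝ)⁻¹ := by
        rw [← div_eq_mul_inv, le_div_iff₀ hposA, inv_mul_le_iff₀ hpos']
        linarith
      rw [abs_le]
      constructor <;> linarith
  have hA0 : (0 : ℝ) ≤ (A.card : ℝ)⁻¹ := by positivity
  have hterm : ∀ i, ∑ x ∈ T, |(A.card : ℝ)⁻¹ * f i x -
      (if i ∈ A' then (A'.card : ℝ)⁻¹ * g i x else 0)| ≤ (A.card : ℝ)⁻¹ := by
    intro i
    have hbound : ∀ x ∈ T, |(A.card : ℝ)⁻¹ * f i x -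
        (if i ∈ A' then (A'.card : ℝ)⁻¹ * g i x else 0)| ≤ (A.card : ℝ)⁻¹ * f i x := by
      intro x _
      have hself : |(A.card : ℝ)⁻¹ * f i x| ≤ (A.card : ℝ)⁻¹ * f i x :=
        (abs_of_nonneg (mul_nonneg hA0 (hf i x))).le
      split_ifs
      · rcases hg i with h | h
        · rw [h, ← sub_mul, abs_mul, abs_of_nonneg (hf i x)]
          exact mul_le_mul_of_nonneg_right hcoef (hf i x)
        · simpa [h] using hself
      · simpa using hself
    calc _ ≤ ∑ x ∈ T, (A.card : ℝ)⁻¹ * f i x := Finset.sum_le_sum hbound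
      _ ≤ (A.card : ℝ)⁻¹ := by
        rw [← Finset.mul_sum]
        exact mul_le_of_le_one_right hA0 (hf1 i)
  calc ∑ x ∈ T, |(A.card : ℝ)⁻¹ * ∑ i ∈ A, f i x - (A'.card : ℝ)⁻¹ * ∑ i ∈ A', g i x|
      ≤ ∑ x ∈ T, ∑ i ∈ A, |(A.card : ℝ)⁻¹ * f i x -
          (if i ∈ A' then (A'.card : ℝ)⁻¹ * g i x else 0)| := by
        refine Finset.sum_le_sum fun x _ => ?_
        have hA' : (A'.card : ℝ)⁻¹ * ∑ i ∈ A', g i x =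
            ∑ i ∈ A, if i ∈ A' then (A'.card : ℝ)⁻¹ * g i x else 0 := by
          rw [Finset.sum_ite_mem, Finset.inter_eq_right.2 hsub, Finset.mul_sum]
        rw [hA', Finset.mul_sum, ← Finset.sum_sub_distrib]
        exact Finset.abs_sum_le_sum_abs _ _
    _ = ∑ i ∈ A, ∑ x ∈ T, |(A.card : ℝ)⁻¹ * f i x -
          (if i ∈ A' then (A'.card : ℝ)⁻¹ * g i x else 0)| := Finset.sum_comm
    _ ≤ ∑ _i ∈ A, (A.card : ℝ)⁻¹ := Finset.sum_le_sum fun i _ => hterm i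
    _ ≤ 1 := by
        rw [Finset.sum_const, nsmul_eq_mul]
        exact mul_inv_le_one

/-- Comparison of the uniform average of the weights `D v` over all `v` with the uniform average
of weights `D' v` over all `v ≠ u`, when `D v = D' v` for `v` outside `B`. -/
theorem sum_abs_average_sub_average_erase_le {V Ω : Type*} [Fintype V] [DecidableEq V]
    (T : Finset Ω) (u : V) {B : Finset V} (hu : u ∈ B) {D D' : V → Ω → ℝ}
    (hD : ∀ x, 0 ≤ D u x) (hD1 : ∑ x ∈ T, D u x ≤ 1)
    (hD' : ∀ v x, 0 ≤ D' v x) (hD'1 : ∀ v, ∑ x ∈ T, D' v x ≤ 1)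
    (hdiff : ∀ v, v ≠ u → ∑ x ∈ T, |D v x - D' v x| ≤ 1)
    (hfar : ∀ v, v ∉ B → D v = D' v) :
    ∑ x ∈ T, |((Finset.univ : Finset V).card : ℝ)⁻¹ * ∑ v, D v x -
        ((Finset.univ.erase u).card : ℝ)⁻¹ * ∑ v ∈ Finset.univ.erase u, D' v x| ≤
      ((B.card : ℝ) + 1) / (Fintype.card V : ℝ) := by
  set E : Finset V := Finset.univ.erase u with hE
  set n : ℝ := ((Finset.univ : Finset V).card : ℝ) with hn
  set m : ℝ := (E.card : ℝ) with hm
  have hnm : n = m + 1 := by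
    have : E.card + 1 = (Finset.univ : Finset V).card := Finset.card_erase_add_one (mem_univ u)
    rw [hn, hm, ← this]
    push_cast
    rfl
  have hm0 : 0 ≤ m := Nat.cast_nonneg _
  have hn0 : 0 < n := by linarith
  have hcoef : |n⁻¹ - m⁻¹| * m ≤ n⁻¹ := by
    rcases hm0.eq_or_lt with h | h
    · rw [← h, mul_zero]
      positivity
    · have hinv : n⁻¹ ≤ m⁻¹ := by
        gcongr
        linarith
      rw [abs_sub_comm, abs_of_nonneg (sub_nonneg.2 hinv), sub_mul, inv_mul_cancel₀ h.ne']
      have : n⁻¹ * m = 1 - n⁻¹ := by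
        have := inv_mul_cancel₀ hn0.ne'
        have hm' : m = n - 1 := by linarith
        rw [hm', mul_sub, this, mul_one]
      linarith
  have hpoint : ∀ x ∈ T, |n⁻¹ * ∑ v, D v x - m⁻¹ * ∑ v ∈ E, D' v x| ≤
      n⁻¹ * (D u x + ∑ v ∈ E, |D v x - D' v x|) + |n⁻¹ - m⁻¹| * ∑ v ∈ E, D' v x := by
    intro x _
    have hsplit : n⁻¹ * ∑ v, D v x - m⁻¹ * ∑ v ∈ E, D' v x =
        n⁻¹ * (D u x + ∑ v ∈ E, (D v x - D' v x)) + (n⁻¹ - m⁻¹) * ∑ v ∈ E, D' v x := by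
      rw [← Finset.add_sum_erase _ _ (mem_univ u), Finset.sum_sub_distrib]
      ring
    rw [hsplit]
    refine (abs_add_le _ _).trans (add_le_add ?_ ?_)
    · rw [abs_mul, abs_of_nonneg (inv_nonneg.2 hn0.le)]
      refine mul_le_mul_of_nonneg_left ?_ (inv_nonneg.2 hn0.le)
      refine (abs_add_le _ _).trans (add_le_add (abs_of_nonneg (hD x)).le ?_)
      exact Finset.abs_sum_le_sum_abs _ _
    · rw [abs_mul, abs_of_nonneg (Finset.sum_nonneg fun v _ => hD' v x)]
  have hnear : ∑ v ∈ E, ∑ x ∈ T, |D v x - D' v x| ≤ (B.card : ℝ) - 1 := by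
    calc ∑ v ∈ E, ∑ x ∈ T, |D v x - D' v x|
        = ∑ v ∈ B.erase u, ∑ x ∈ T, |D v x - D' v x| := by
          symm
          refine Finset.sum_subset (Finset.erase_subset_erase _ (Finset.subset_univ _)) ?_
          intro v hvE hvB
          have : v ∉ B := fun h => hvB (mem_erase.2 ⟨(mem_erase.1 hvE).1, h⟩)
          simp [hfar v this]
      _ ≤ ∑ _v ∈ B.erase u, (1 : ℝ) :=
          Finset.sum_le_sum fun v hv => hdiff v (mem_erase.1 hv).1
      _ = (B.card : ℝ) - 1 := by
          rw [Finset.sum_const, nsmul_eq_mul, mul_one, ← Finset.card_erase_add_one hu]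
          push_cast
          ring
  have hmass : ∑ v ∈ E, ∑ x ∈ T, D' v x ≤ m := by
    refine (Finset.sum_le_sum fun v _ => hD'1 v).trans ?_
    simp [hm]
  calc _ ≤ ∑ x ∈ T, (n⁻¹ * (D u x + ∑ v ∈ E, |D v x - D' v x|) +
          |n⁻¹ - m⁻¹| * ∑ v ∈ E, D' v x) := Finset.sum_le_sum hpoint
    _ = n⁻¹ * (∑ x ∈ T, D u x + ∑ v ∈ E, ∑ x ∈ T, |D v x - D' v x|) +
          |n⁻¹ - m⁻¹| * ∑ v ∈ E, ∑ x ∈ T, D' v x := by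
        rw [Finset.sum_add_distrib, ← Finset.mul_sum, ← Finset.mul_sum, Finset.sum_add_distrib,
          Finset.sum_comm (s := T) (t := E), Finset.sum_comm (s := T) (t := E)]
    _ ≤ n⁻¹ * (1 + ((B.card : ℝ) - 1)) + |n⁻¹ - m⁻¹| * m := by gcongr
    _ ≤ n⁻¹ * (1 + ((B.card : ℝ) - 1)) + n⁻¹ := by gcongr
    _ = ((B.card : ℝ) + 1) / (Fintype.card V : ℝ) := by
        rw [← Finset.card_univ, ← hn]
        ring

/-- bounded differences between the flip dynamics and the conditional flip
dynamics.  Fix a list-coloring instance `(G, L)` with `n` vertices, flip parameters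
`p_j ∈ [0,1]` vanishing for `j ≥ 7`, a vertex `u` and a color `c ∈ L u` attained at `u` by
some proper list-coloring.  Let `P_{μ,flip}` be the flip dynamics for `(G, L)` and let
`P_{μ∣uc,flip}` be the flip dynamics for the instance with the color of `u` fixed to `c`
(active vertices `V ∖ {u}`, the color `c` deleted from the pick-lists of the neighbors of
`u`), viewed as a chain on proper list-colorings `τ` with `τ u = c`.  Then for every proper
list-coloring `τ` with `τ u = c`,
`∑_{σ ≠ τ} |P_{μ,flip}(τ→σ) − P_{μ∣uc,flip}(τ→σ)| ≤ (|B(u,6)| + 1)/n`,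
where `B(u,6)` is the ball of radius `6` around `u` in the graph metric. -/
theorem flip_dynamics_bounded_differences
    {V : Type*} [Fintype V] [DecidableEq V] {q : ℕ}
    (G : SimpleGraph V) (L : V → Finset (Fin q)) (p : ℕ → ℝ)
    (hp : ∀ j, 0 ≤ p j ∧ p j ≤ 1) (hp7 : ∀ j, 7 ≤ j → p j = 0)
    (u : V) (c : Fin q) (hc : c ∈ L u)
    (hex : ∃ σ : V → Fin q, IsProperListColoring G L σ ∧ σ u = c) :
    ∀ τ : V → Fin q, IsProperListColoring G L τ → τ u = c →
      ∑ σ ∈ Finset.univ.erase τ,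
          |flipMatrix G Finset.univ L L p τ σ -
            flipMatrix G (Finset.univ.erase u)
              (fun v => if G.Adj u v then (L v).erase c else L v) L p τ σ|
        ≤ (((Finset.univ.filter fun v => G.Reachable u v ∧ G.dist u v ≤ 6).card : ℝ) + 1) /
            (Fintype.card V : ℝ) := by
  intro τ hτ hτu
  set L' : V → Finset (Fin q) := fun v => if G.Adj u v then (L v).erase c else L v with hL'
  have hsub : ∀ v, L' v ⊆ L v := fun v => by
    simp only [hL']
    split_ifs
    · exact Finset.erase_subset _ _
    · exact subset_rfl
  have hcard : ∀ v, (L v).card ≤ 2 * (L' v).card := fun v => by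
    simp only [hL']
    split_ifs with hadj
    · have hne : τ v ≠ c := fun h => hτ.2 u v hadj (hτu.trans h.symm)
      have hpos : 0 < ((L v).erase c).card :=
        Finset.card_pos.2 ⟨τ v, mem_erase.2 ⟨hne, hτ.1 v⟩⟩
      have := Finset.pred_card_le_card_erase (s := L v) (a := c)
      omega
    · omega
  have hw : ∀ (Vs : Finset V) v d σ, 0 ≤ flipWeight G Vs L p τ v d σ := fun Vs v d σ =>
    flipWeight_nonneg (fun j => (hp j).1) τ v d σ
  have hw1 : ∀ (Vs : Finset V) v d,
      ∑ σ ∈ Finset.univ.erase τ, flipWeight G Vs L p τ v d σ ≤ 1 := fun Vs v d =>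
    sum_flipWeight_le_one hp τ v d _
  rw [Finset.sum_congr rfl fun σ hσ => by
    rw [flipMatrix_apply_of_ne (mem_erase.1 hσ).1, flipMatrix_apply_of_ne (mem_erase.1 hσ).1]]
  refine sum_abs_average_sub_average_erase_le (Finset.univ.erase τ) u
    (D := fun v σ => ((L v).card : ℝ)⁻¹ * ∑ d ∈ L v, flipWeight G Finset.univ L p τ v d σ)
    (D' := fun v σ =>
      ((L' v).card : ℝ)⁻¹ * ∑ d ∈ L' v, flipWeight G (Finset.univ.erase u) L p τ v d σ)
    (by simp) (fun σ => mul_nonneg (by positivity) (Finset.sum_nonneg fun d _ => hw _ u d σ))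
    (sum_inv_card_mul_sum_le_one _ _ (hw1 _ u))
    (fun v σ => mul_nonneg (by positivity) (Finset.sum_nonneg fun d _ => hw _ v d σ))
    (fun v => sum_inv_card_mul_sum_le_one _ _ (hw1 _ v))
    (fun v hv => sum_abs_mixture_sub_le_one _ (hsub v) (hcard v) (hw _ v) (hw1 _ v)
      (flipWeight_erase_eq_or hv)) ?_
  intro v hv
  have hfar : ¬ (G.Reachable u v ∧ G.dist u v ≤ 6) := by simpa using hv
  have hvu : v ≠ u := by
    rintro rfl
    exact hfar ⟨SimpleGraph.Reachable.refl _, by simp⟩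
  have hLv : L' v = L v := if_neg fun hadj =>
    hfar ⟨hadj.reachable, by rw [SimpleGraph.dist_eq_one_iff_adj.2 hadj]; omega⟩
  funext σ
  simp only [hLv, flipWeight_erase_eq_of_far (r := 6) (fun j hj => hp7 j hj) hvu hfar]
end
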